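/- Let d ≥ 1 and let 1 ≤ p₀, p₁, p₂, q₁, q₂, q₃, r₀, r₁, r₂, s₁, s₂, s₃ ≤ ∞ satisfy the monotonicity chain conditions 1 ≤ r₀′ ≤ p₁ ≤ r₁′ ≤ p₂ ≤ r₂′ ≤ ∞ and 1 ≤ s₁′ ≤ q₁ ≤ s₂′ ≤ q₂ ≤ s₃′ ≤ ∞ (where a′ denotes the conjugate exponent, 1/a + 1/a′ = 1), together with 1/r₀ + 1/p₁ + 1/r₁ + 1/p₂ + 1/r₂ ≥ 2 + 1/p₀ and 1/s₃ + 1/q₁ + 1/s₁ + 1/q₂ + 1/s₂ ≥ 2 + 1/q₃. Then there is a constant C > 0 (depending only on d and the exponents) such that for every bounded measurable σ : ℝ^{3d} → ℂ with ‖σ‖_{𝓜^{(r₀,r₁,r₂);(s₁,s₂,s₃)}} < ∞ and all Schwartz f₁, f₂ on ℝ^d: ‖T_σ(f₁,f₂)‖_{M^{p₀,q₃}} ≤ C · ‖σ‖_{𝓜^{(r₀,r₁,r₂);(s₁,s₂,s₃)}} · ‖f₁‖_{M^{p₁,q₁}} · ‖f₂‖_{M^{p₂,q₂}}. -/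

import Mathlib

open MeasureTheory Complex
open scoped ENNReal NNReal RealInnerProductSpace

noncomputable section

abbrev Ed (d : ℕ) := EuclideanSpace ℝ (Fin d)

/-- `e2pi a = e^{2πi a}`. -/
def e2pi (a : ℝ) : ℂ := Complex.exp (2 * Real.pi * Complex.I * (a : ℂ))

/-- Short-time Fourier transform `V_φ f (t, ν)`. -/
def STFT (d : ℕ) (φ f : Ed d → ℂ) (t ν : Ed d) : ℂ :=
  ∫ y, f y * e2pi (-⟪y, ν⟫) * φ (y - t)

/-- The Gaussian window `e^{-‖x‖²}` as a complex-valued function. -/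
def gauss (d : ℕ) : Ed d → ℂ := fun x => (Real.exp (-‖x‖ ^ 2) : ℝ)

/-- `L^p`-type norm (`ℝ≥0∞`-valued) with essential supremum in case `p = ∞`. -/
def eNorm {α : Type*} [MeasurableSpace α] (μ : Measure α) (p : ℝ≥0∞) (F : α → ℝ≥0∞) : ℝ≥0∞ :=
  if p = ∞ then essSup F μ else (∫⁻ a, F a ^ p.toReal ∂μ) ^ (1 / p.toReal)

/-- Modulation space norm `‖f‖_{M^{p,q}}` with the Gaussian window. -/
def modNorm (d : ℕ) (p q : ℝ≥0∞) (f : Ed d → ℂ) : ℝ≥0∞ :=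
  eNorm volume q fun ν => eNorm volume p fun t => (‖STFT d (gauss d) f t ν‖₊ : ℝ≥0∞)

/-- The Gaussian window on `ℝ^{3d}`. -/
def gauss3 (d : ℕ) : Ed d × Ed d × Ed d → ℂ :=
  fun X => (Real.exp (-‖X.1‖ ^ 2 - ‖X.2.1‖ ^ 2 - ‖X.2.2‖ ^ 2) : ℝ)

/-- Symbol short-time Fourier transform of a symbol on `ℝ^{3d}`. -/
def symbSTFT (d : ℕ) (Φ σ : Ed d × Ed d × Ed d → ℂ) (x t₁ t₂ ξ₁ ξ₂ ν : Ed d) : ℂ :=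
  ∫ X : Ed d × Ed d × Ed d,
    σ X * Φ (X.1 - x, X.2.1 - ξ₁, X.2.2 - ξ₂) *
      e2pi (-(⟪X.1, ν⟫ - ⟪t₁, X.2.1⟫ - ⟪t₂, X.2.2⟫))

/-- Fourier transform. -/
def FT (d : ℕ) (f : Ed d → ℂ) (ξ : Ed d) : ℂ := ∫ y, f y * e2pi (-⟪y, ξ⟫)

/-- Bilinear pseudodifferential operator `T_σ`. -/
def biOp (d : ℕ) (σ : Ed d × Ed d × Ed d → ℂ) (f₁ f₂ : Ed d → ℂ) (x : Ed d) : ℂ :=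
  ∫ ξ : Ed d × Ed d,
    e2pi ⟪x, ξ.1 + ξ.2⟫ * σ (x, ξ.1, ξ.2) * FT d f₁ ξ.1 * FT d f₂ ξ.2


/-- The symbol-modulation norm `‖σ‖_{𝓜^{(r₀,r₁,r₂);(s₁,s₂,s₃)}}`: iterated mixed norm of
`𝒱_Φ σ`, integrating `x` with exponent `r₀` (innermost), then `t₁, t₂` with `r₁, r₂`,
then `ξ₁, ξ₂` with `s₁, s₂`, and `ν` with `s₃` (outermost); essential suprema for `∞`. -/
def symbNorm (d : ℕ) (r₀ r₁ r₂ s₁ s₂ s₃ : ℝ≥0∞) (σ : Ed d × Ed d × Ed d → ℂ) : ℝ≥0∞ :=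
  eNorm volume s₃ (fun ν => eNorm volume s₂ (fun ξ₂ => eNorm volume s₁ (fun ξ₁ =>
    eNorm volume r₂ (fun t₂ => eNorm volume r₁ (fun t₁ => eNorm volume r₀ (fun x =>
      (‖symbSTFT d (gauss3 d) σ x t₁ t₂ ξ₁ ξ₂ ν‖₊ : ℝ≥0∞)))))))

section MixedNorms

variable {α β : Type*} [MeasurableSpace α] [MeasurableSpace β] {μ : Measure α} {ν : Measure β}

theorem eNorm_top (F : α → ℝ≥0∞) : eNorm μ ∞ F = essSup F μ := if_pos rfl

theorem eNorm_of_ne_top {p : ℝ≥0∞} (hp : p ≠ ∞) (F : α → ℝ≥0∞) :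
    eNorm μ p F = (∫⁻ a, F a ^ p.toReal ∂μ) ^ (1 / p.toReal) := if_neg hp

theorem eNorm_one (F : α → ℝ≥0∞) : eNorm μ 1 F = ∫⁻ a, F a ∂μ := by
  simp [eNorm_of_ne_top]

theorem eNorm_mono_ae (p : ℝ≥0∞) {F G : α → ℝ≥0∞} (h : ∀ᵐ a ∂μ, F a ≤ G a) :
    eNorm μ p F ≤ eNorm μ p G := by
  by_cases hp : p = ∞
  · subst hp
    rw [eNorm_top, eNorm_top]
    exact essSup_mono_ae h
  · rw [eNorm_of_ne_top hp, eNorm_of_ne_top hp]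
    refine ENNReal.rpow_le_rpow (lintegral_mono_ae ?_) (by positivity)
    filter_upwards [h] with a ha
    exact ENNReal.rpow_le_rpow ha ENNReal.toReal_nonneg

theorem eNorm_mono (p : ℝ≥0∞) {F G : α → ℝ≥0∞} (h : ∀ a, F a ≤ G a) :
    eNorm μ p F ≤ eNorm μ p G :=
  eNorm_mono_ae p (Filter.Eventually.of_forall h)

theorem toReal_pos_of_one_le {p : ℝ≥0∞} (hp : 1 ≤ p) (hp' : p ≠ ∞) : 0 < p.toReal :=
  ENNReal.toReal_pos (zero_lt_one.trans_le hp).ne' hp'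

theorem eNorm_rpow_toReal {p : ℝ≥0∞} (hp : 1 ≤ p) (hp' : p ≠ ∞) (F : α → ℝ≥0∞) :
    eNorm μ p F ^ p.toReal = ∫⁻ a, F a ^ p.toReal ∂μ := by
  rw [eNorm_of_ne_top hp', ← ENNReal.rpow_mul,
    one_div_mul_cancel (toReal_pos_of_one_le hp hp').ne', ENNReal.rpow_one]

theorem eNorm_le_of_lintegral_le {p : ℝ≥0∞} (hp : 1 ≤ p) (hp' : p ≠ ∞) {F : α → ℝ≥0∞} {C : ℝ≥0∞}
    (h : ∫⁻ a, F a ^ p.toReal ∂μ ≤ C ^ p.toReal) : eNorm μ p F ≤ C := by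
  rw [eNorm_of_ne_top hp', one_div, ENNReal.rpow_inv_le_iff (toReal_pos_of_one_le hp hp')]
  exact h

theorem eNorm_const_mul {p : ℝ≥0∞} (hp : 1 ≤ p) (c : ℝ≥0∞) {F : α → ℝ≥0∞} (hF : Measurable F) :
    eNorm μ p (fun a => c * F a) = c * eNorm μ p F := by
  by_cases hp' : p = ∞
  · subst hp'
    rw [eNorm_top, eNorm_top, ENNReal.essSup_const_mul]
  · have h0 := toReal_pos_of_one_le hp hp'
    rw [eNorm_of_ne_top hp', eNorm_of_ne_top hp']
    simp_rw [ENNReal.mul_rpow_of_nonneg _ _ h0.le]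
    rw [lintegral_const_mul _ (hF.pow_const _), ENNReal.mul_rpow_of_nonneg _ _ (by positivity),
      ← ENNReal.rpow_mul, mul_one_div_cancel h0.ne', ENNReal.rpow_one]

theorem measurable_eNorm [SFinite ν] (p : ℝ≥0∞) {F : α → β → ℝ≥0∞}
    (hF : Measurable (Function.uncurry F)) : Measurable fun a => eNorm ν p (F a) := by
  by_cases hp : p = ∞
  · subst hp
    refine measurable_of_Iic fun c => ?_
    have : (fun a => eNorm ν ∞ (F a)) ⁻¹' Set.Iic c =
        {a | ν (Prod.mk a ⁻¹' (Function.uncurry F ⁻¹' Set.Ioi c)) = 0} := by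
      ext a
      simp only [Set.mem_preimage, Set.mem_Iic, eNorm_top, Set.mem_ofPred_eq]
      constructor
      · intro h
        have := ENNReal.ae_le_essSup (μ := ν) (F a)
        rw [ae_iff] at this
        refine measure_mono_null (fun b hb => ?_) this
        simp only [Set.mem_preimage, Function.uncurry_apply_pair, Set.mem_Ioi] at hb
        simpa using h.trans_lt hb
      · intro h
        refine essSup_le_of_ae_le _ ?_
        rw [Filter.EventuallyLE, ae_iff]
        convert h using 2
        ext b
        simp
    rw [this]
    exact measurable_measure_prodMk_left (hF measurableSet_Ioi) (measurableSet_singleton 0)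
  · simp_rw [eNorm_of_ne_top hp]
    exact ((hF.pow_const _).lintegral_prod_right').pow_const _

theorem eNorm_mul_le {p q u : ℝ≥0∞} (hp : 1 ≤ p) (hq : 1 ≤ q) (hu : 1 ≤ u)
    (h : u⁻¹ = p⁻¹ + q⁻¹) {F G : α → ℝ≥0∞} (hF : Measurable F) (hG : Measurable G) :
    eNorm μ u (fun a => F a * G a) ≤ eNorm μ p F * eNorm μ q G := by
  by_cases hp' : p = ∞
  · subst hp'
    obtain rfl : u = q := by simpa using h
    rw [eNorm_top, ← eNorm_const_mul hu _ hG]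
    refine eNorm_mono_ae _ ?_
    filter_upwards [ENNReal.ae_le_essSup (μ := μ) F] with a ha
    gcongr
  by_cases hq' : q = ∞
  · subst hq'
    obtain rfl : u = p := by simpa using h
    rw [eNorm_top, mul_comm, ← eNorm_const_mul hu _ hF]
    refine eNorm_mono_ae _ ?_
    filter_upwards [ENNReal.ae_le_essSup (μ := μ) G] with a ha
    rw [mul_comm]
    gcongr
  have hp0 := toReal_pos_of_one_le hp hp'
  have hq0 := toReal_pos_of_one_le hq hq'
  have hu' : u ≠ ∞ := by
    rintro rfl
    simp at h
    exact hp' (by simpa using (add_eq_zero.1 h.symm).1)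
  have hu0 := toReal_pos_of_one_le hu hu'
  have hr : u.toReal⁻¹ = p.toReal⁻¹ + q.toReal⁻¹ := by
    have := congrArg ENNReal.toReal h
    rwa [ENNReal.toReal_add (by simp; positivity) (by simp; positivity), ENNReal.toReal_inv,
      ENNReal.toReal_inv, ENNReal.toReal_inv] at this
  refine eNorm_le_of_lintegral_le hu hu' ?_
  set P := p.toReal
  set Q := q.toReal
  set U := u.toReal
  have h1 : U / P + U / Q = 1 := by
    rw [div_eq_mul_inv, div_eq_mul_inv, ← mul_add, ← hr, mul_inv_cancel₀ hu0.ne']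
  have key := ENNReal.lintegral_mul_norm_pow_le (μ := μ) (hF.pow_const P).aemeasurable
    (hG.pow_const Q).aemeasurable (p := U / P) (q := U / Q) (by positivity) (by positivity) h1
  have e : ∀ x : ℝ≥0∞, (x ^ P) ^ (U / P) = x ^ U := fun x => by
    rw [← ENNReal.rpow_mul, mul_div_cancel₀ _ hp0.ne']
  have e' : ∀ x : ℝ≥0∞, (x ^ Q) ^ (U / Q) = x ^ U := fun x => by
    rw [← ENNReal.rpow_mul, mul_div_cancel₀ _ hq0.ne']
  simp_rw [e, e', ← ENNReal.mul_rpow_of_nonneg _ _ hu0.le] at key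
  refine key.trans_eq ?_
  rw [← eNorm_rpow_toReal hp hp', ← eNorm_rpow_toReal hq hq', e, e',
    ENNReal.mul_rpow_of_nonneg _ _ hu0.le]

theorem lintegral_mul_le_eNorm {p q : ℝ≥0∞} (h : p⁻¹ + q⁻¹ = 1) {F G : α → ℝ≥0∞}
    (hF : Measurable F) (hG : Measurable G) :
    ∫⁻ a, F a * G a ∂μ ≤ eNorm μ p F * eNorm μ q G := by
  have hp : 1 ≤ p := by
    rw [← ENNReal.inv_le_one]; exact le_self_add.trans h.le
  have hq : 1 ≤ q := by
    rw [← ENNReal.inv_le_one]; exact le_add_self.trans h.le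
  simpa [eNorm_one] using eNorm_mul_le hp hq le_rfl (by simpa using h.symm) hF hG (μ := μ)

theorem eNorm_comp_measurePreserving {f : α → β} (hf : MeasurePreserving f μ ν) (p : ℝ≥0∞)
    {F : β → ℝ≥0∞} (hF : Measurable F) : eNorm μ p (fun a => F (f a)) = eNorm ν p F := by
  by_cases hp : p = ∞
  · subst hp
    rw [eNorm_top, eNorm_top, ← hf.map_eq,
      essSup_map_measure_of_measurable hF hf.measurable.aemeasurable]
    rfl
  · rw [eNorm_of_ne_top hp, eNorm_of_ne_top hp, ← hf.lintegral_comp (hF.pow_const _)]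

theorem eNorm_le_of_forall_lintegral_mul_le [SigmaFinite μ] {p q : ℝ≥0∞} (h : p⁻¹ + q⁻¹ = 1)
    {G : α → ℝ≥0∞} (hG : Measurable G) {C : ℝ≥0∞}
    (hC : ∀ k : α → ℝ≥0∞, Measurable k → ∫⁻ a, k a * G a ∂μ ≤ C * eNorm μ q k) :
    eNorm μ p G ≤ C := by
  have hp : 1 ≤ p := by
    rw [← ENNReal.inv_le_one]; exact le_self_add.trans h.le
  by_cases hp' : p = ∞
  · subst hp'
    obtain rfl : q = 1 := by simpa using h
    rw [eNorm_top]
    refine essSup_le_of_ae_le _ ?_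
    refine ae_le_of_forall_setLIntegral_le_of_sigmaFinite hG fun s hs _ => ?_
    have := hC (s.indicator 1) (measurable_one.indicator hs)
    rw [eNorm_one, lintegral_indicator_one hs] at this
    rw [lintegral_const, Measure.restrict_apply_univ, ← lintegral_indicator hs]
    refine le_trans (le_of_eq ?_) this
    congr 1 with a
    by_cases ha : a ∈ s <;> simp [ha]
  by_cases hp1 : p = 1
  · subst hp1
    obtain rfl : q = ∞ := by
      have : (1 : ℝ≥0∞) + q⁻¹ = 1 + 0 := by simpa using h
      simpa using (ENNReal.add_right_inj ENNReal.one_ne_top).1 this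
    rw [eNorm_one]
    have := hC (fun _ => 1) measurable_const
    simp only [one_mul, eNorm_top] at this
    refine this.trans ?_
    calc C * essSup (fun _ : α => (1 : ℝ≥0∞)) μ ≤ C * 1 := by
          gcongr
          exact essSup_le_of_ae_le _ (Filter.Eventually.of_forall fun _ => le_rfl)
      _ = C := mul_one C
  have hlt : 1 < p := lt_of_le_of_ne hp (Ne.symm hp1)
  have hq : 1 ≤ q := by
    rw [← ENNReal.inv_le_one]; exact le_add_self.trans h.le
  have hq' : q ≠ ∞ := by
    rintro rfl
    simp only [ENNReal.inv_top, add_zero, ENNReal.inv_eq_one] at h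
    exact hp1 h
  have hp0 := toReal_pos_of_one_le hp hp'
  have hq0 := toReal_pos_of_one_le hq hq'
  have hr : p.toReal⁻¹ + q.toReal⁻¹ = 1 := by
    have := congrArg ENNReal.toReal h
    rwa [ENNReal.toReal_add (by simp; positivity) (by simp; positivity), ENNReal.toReal_inv,
      ENNReal.toReal_inv, ENNReal.toReal_one] at this
  by_cases hCt : C = ∞
  · simp [hCt]
  refine eNorm_le_of_lintegral_le hp hp' ?_
  set P := p.toReal with hP
  set Q := q.toReal with hQ
  have hP1 : 1 < P := by
    rw [hP, ← ENNReal.toReal_one]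
    exact (ENNReal.toReal_lt_toReal ENNReal.one_ne_top hp').2 hlt
  have hPQ : (P - 1) * Q = P := by
    field_simp at hr
    linarith
  have hPinv : 1 / Q = 1 - 1 / P := by simp only [one_div]; linarith
  let Gn : ℕ → α → ℝ≥0∞ := fun n => (spanningSets μ n).indicator fun a => min (G a) n
  have hGn : ∀ n, Measurable (Gn n) := fun n =>
    (hG.min measurable_const).indicator (measurableSet_spanningSets μ n)
  have hle : ∀ n a, Gn n a ≤ G a := fun n a => by
    by_cases ha : a ∈ spanningSets μ n <;> simp [Gn, ha]
  have hbd : ∀ n, ∫⁻ a, Gn n a ^ P ∂μ ≤ C ^ P := by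
    intro n
    set A := ∫⁻ a, Gn n a ^ P ∂μ with hA
    have hAt : A ≠ ∞ := by
      have : A ≤ ∫⁻ a in spanningSets μ n, (n : ℝ≥0∞) ^ P ∂μ := by
        rw [hA, ← lintegral_indicator (measurableSet_spanningSets μ n)]
        refine lintegral_mono fun a => ?_
        by_cases ha : a ∈ spanningSets μ n
        · simp only [Gn, ha, Set.indicator_of_mem]
          exact ENNReal.rpow_le_rpow (min_le_right _ _) hp0.le
        · simp [Gn, ha, hp0]
      refine ne_top_of_le_ne_top ?_ this
      rw [lintegral_const, Measure.restrict_apply_univ]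
      exact ENNReal.mul_ne_top (ENNReal.rpow_ne_top_of_nonneg hp0.le (by simp))
        (measure_spanningSets_lt_top μ n).ne
    have h1 := hC (fun a => Gn n a ^ (P - 1)) ((hGn n).pow_const _)
    have h2 : A ≤ ∫⁻ a, Gn n a ^ (P - 1) * G a ∂μ := by
      refine lintegral_mono fun a => ?_
      calc Gn n a ^ P = Gn n a ^ (P - 1) * Gn n a := by
            conv_rhs => rw [← ENNReal.rpow_one (Gn n a), ← ENNReal.rpow_mul]
            rw [← ENNReal.rpow_add_of_nonneg _ _ (by simp; linarith) zero_le_one]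
            simp
        _ ≤ _ := by gcongr; exact hle n a
    have h3 : eNorm μ q (fun a => Gn n a ^ (P - 1)) = A ^ (1 / Q) := by
      rw [eNorm_of_ne_top hq', ← hQ]
      simp_rw [← ENNReal.rpow_mul, hPQ]
      rfl
    rw [h3] at h1
    have h4 := h2.trans h1
    by_cases hA0 : A = 0
    · simp [hA0]
    have h5 : A ^ (1 / P) ≤ C := by
      have : A ^ (1 / P) * A ^ (1 / Q) ≤ C * A ^ (1 / Q) := by
        rw [← ENNReal.rpow_add _ _ hA0 hAt, hPinv, add_sub_cancel, ENNReal.rpow_one, ← hPinv]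
        exact h4
      refine (ENNReal.mul_le_mul_iff_left ?_ ?_).1 this
      · exact (ENNReal.rpow_pos (pos_iff_ne_zero.2 hA0) hAt).ne'
      · exact ENNReal.rpow_ne_top_of_nonneg (by positivity) hAt
    rwa [one_div, ENNReal.rpow_inv_le_iff hp0] at h5
  have hmono : Monotone fun n a => Gn n a ^ P := by
    intro m n hmn a
    refine ENNReal.rpow_le_rpow ?_ hp0.le
    by_cases ha : a ∈ spanningSets μ m
    · have ha' := monotone_spanningSets μ hmn ha
      simp only [Gn, ha, ha', Set.indicator_of_mem]
      gcongr
    · simp [Gn, ha]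
  have hsup : ∀ a, G a ^ P ≤ ⨆ n, Gn n a ^ P := by
    intro a
    obtain ⟨m, hm⟩ := Set.mem_iUnion.1 ((iUnion_spanningSets μ).ge (Set.mem_univ a))
    have hev : ∀ᶠ n : ℕ in Filter.atTop, min (G a) n ^ P ≤ ⨆ n, Gn n a ^ P := by
      filter_upwards [Filter.eventually_ge_atTop m] with n hn
      refine le_iSup_of_le n ?_
      simp [Gn, monotone_spanningSets μ hn hm]
    have htend : Filter.Tendsto (fun n : ℕ => min (G a) n ^ P) Filter.atTop
        (nhds (G a ^ P)) := by
      have : Filter.Tendsto (fun n : ℕ => min (G a) (n : ℝ≥0∞)) Filter.atTop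
          (nhds (min (G a) ∞)) :=
        tendsto_const_nhds.min ENNReal.tendsto_nat_nhds_top
      rw [min_eq_left le_top] at this
      exact (ENNReal.continuous_rpow_const.tendsto _).comp this
    exact le_of_tendsto htend hev
  calc ∫⁻ a, G a ^ P ∂μ ≤ ∫⁻ a, ⨆ n, Gn n a ^ P ∂μ := lintegral_mono hsup
    _ = ⨆ n, ∫⁻ a, Gn n a ^ P ∂μ := lintegral_iSup (fun n => (hGn n).pow_const _) hmono
    _ ≤ C ^ P := iSup_le hbd

end MixedNorms

section Multilinear

variable {d : ℕ}

theorem lintegral_mul_mul_rpow_le {α : Type*} [MeasurableSpace α] {μ : Measure α}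
    {A B C : α → ℝ≥0∞} (hA : Measurable A) (hB : Measurable B) (hC : Measurable C) {x y z : ℝ}
    (hx : 0 ≤ x) (hy : 0 ≤ y) (hz : 0 ≤ z) (h : x + y + z = 1) :
    ∫⁻ a, A a ^ x * B a ^ y * C a ^ z ∂μ ≤
      (∫⁻ a, A a ∂μ) ^ x * (∫⁻ a, B a ∂μ) ^ y * (∫⁻ a, C a ∂μ) ^ z := by
  have := ENNReal.lintegral_prod_norm_pow_le (μ := μ) (Finset.univ : Finset (Fin 3))
    (f := ![A, B, C]) (p := ![x, y, z])
    (by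
      intro i _
      fin_cases i
      exacts [hA.aemeasurable, hB.aemeasurable, hC.aemeasurable])
    (by simpa [Fin.sum_univ_three] using h)
    (by
      intro i _
      fin_cases i
      exacts [hx, hy, hz])
  simpa [Fin.prod_univ_three] using this

theorem eNorm_comp_add_right (p : ℝ≥0∞) {F : Ed d → ℝ≥0∞} (hF : Measurable F) (a : Ed d) :
    eNorm volume p (fun x => F (x + a)) = eNorm volume p F :=
  eNorm_comp_measurePreserving (measurePreserving_add_right volume a) p hF

theorem eNorm_comp_sub_right (p : ℝ≥0∞) {F : Ed d → ℝ≥0∞} (hF : Measurable F) (a : Ed d) :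
    eNorm volume p (fun x => F (x - a)) = eNorm volume p F := by
  simpa [sub_eq_add_neg] using eNorm_comp_add_right p hF (-a)

theorem toReal_inv_add_inv {u v p a : ℝ≥0∞} (hu : 1 ≤ u) (hp : 1 ≤ p) (hv : 1 ≤ v) (ha : 1 ≤ a)
    (h : u⁻¹ + v⁻¹ = p⁻¹ + a⁻¹) :
    u.toReal⁻¹ + v.toReal⁻¹ = p.toReal⁻¹ + a.toReal⁻¹ := by
  have aux : ∀ {x : ℝ≥0∞}, 1 ≤ x → x⁻¹ ≠ ∞ := fun hx => by
    simpa using (zero_lt_one.trans_le hx).ne'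
  have := congrArg ENNReal.toReal h
  rwa [ENNReal.toReal_add (aux hu) (aux hv), ENNReal.toReal_add (aux hp) (aux ha),
    ENNReal.toReal_inv, ENNReal.toReal_inv, ENNReal.toReal_inv, ENNReal.toReal_inv] at this

/-- Young's inequality, with the inner integral replaced by an `L^u` norm. -/
theorem eNorm_eNorm_sub_mul_le {u v p a : ℝ≥0∞} (hu : 1 ≤ u) (hp : 1 ≤ p) (hv : 1 ≤ v)
    (ha : 1 ≤ a) (h : u⁻¹ + v⁻¹ = p⁻¹ + a⁻¹) (hvp : v⁻¹ ≤ p⁻¹) (hpu : p⁻¹ ≤ u⁻¹)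
    {g k : Ed d → ℝ≥0∞} (hg : Measurable g) (hk : Measurable k) :
    eNorm volume v (fun t => eNorm volume u fun x => g (x - t) * k x) ≤
      eNorm volume p g * eNorm volume a k := by
  by_cases hv' : v = ∞
  · subst hv'
    rw [eNorm_top]
    refine essSup_le_of_ae_le _ (Filter.Eventually.of_forall fun t => ?_)
    refine (eNorm_mul_le hp ha hu (by simpa using h) (by fun_prop) hk).trans_eq ?_
    rw [eNorm_comp_sub_right p hg]
  have hvpos : 0 < v⁻¹ := by simpa [pos_iff_ne_zero] using hv'
  have hp' : p ≠ ∞ := by simpa using (hvpos.trans_le hvp).ne'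
  have hu' : u ≠ ∞ := by simpa using (hvpos.trans_le (hvp.trans hpu)).ne'
  have hva : v⁻¹ ≤ a⁻¹ := by
    have h1 : p⁻¹ + v⁻¹ ≤ p⁻¹ + a⁻¹ := by rw [← h]; gcongr
    rwa [ENNReal.add_le_add_iff_left (by simpa using (zero_lt_one.trans_le hp).ne')] at h1
  have ha' : a ≠ ∞ := by simpa using (hvpos.trans_le hva).ne'
  have hr := toReal_inv_add_inv hu hp hv ha h
  rw [ENNReal.inv_le_inv] at hvp hpu hva
  replace hvp := ENNReal.toReal_mono hv' hvp
  replace hva := ENNReal.toReal_mono hv' hva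
  replace hpu := ENNReal.toReal_mono hp' hpu
  have hu0 := toReal_pos_of_one_le hu hu'
  have hv0 := toReal_pos_of_one_le hv hv'
  have hp0 := toReal_pos_of_one_le hp hp'
  have ha0 := toReal_pos_of_one_le ha ha'
  refine eNorm_le_of_lintegral_le hv hv' ?_
  simp_rw [eNorm_of_ne_top hu']
  have egP := eNorm_rpow_toReal (μ := volume) hp hp' g
  have ekA := eNorm_rpow_toReal (μ := volume) ha ha' k
  set NG := eNorm volume p g
  set NK := eNorm volume a k
  set U := u.toReal
  set V := v.toReal
  set P := p.toReal
  set A := a.toReal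
  have hx : 0 ≤ U / V := by positivity
  have hy : 0 ≤ U / P - U / V := sub_nonneg.2 (by gcongr)
  have hz : 0 ≤ U / A - U / V := sub_nonneg.2 (by gcongr)
  have hsum : U / V + (U / P - U / V) + (U / A - U / V) = 1 := by
    have : U * (U⁻¹ + V⁻¹) = U * (P⁻¹ + A⁻¹) := by rw [hr]
    rw [mul_add, mul_add, mul_inv_cancel₀ hu0.ne'] at this
    simp only [div_eq_mul_inv]
    linarith
  have split : ∀ x y : ℝ≥0∞, (x * y) ^ U =
      (x ^ P * y ^ A) ^ (U / V) * (x ^ P) ^ (U / P - U / V) * (y ^ A) ^ (U / A - U / V) := by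
    intro x y
    have ex : x ^ U = (x ^ P) ^ (U / V) * (x ^ P) ^ (U / P - U / V) := by
      rw [← ENNReal.rpow_add_of_nonneg _ _ hx hy, add_sub_cancel, ← ENNReal.rpow_mul,
        mul_div_cancel₀ _ hp0.ne']
    have ey : y ^ U = (y ^ A) ^ (U / V) * (y ^ A) ^ (U / A - U / V) := by
      rw [← ENNReal.rpow_add_of_nonneg _ _ hx hz, add_sub_cancel, ← ENNReal.rpow_mul,
        mul_div_cancel₀ _ ha0.ne']
    rw [ENNReal.mul_rpow_of_nonneg _ _ hu0.le, ENNReal.mul_rpow_of_nonneg _ _ hx, ex, ey]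
    ring
  have hVU : 0 ≤ V / U := by positivity
  have step : ∀ t, ((∫⁻ x, (g (x - t) * k x) ^ U) ^ (1 / U)) ^ V ≤
      (∫⁻ x, g (x - t) ^ P * k x ^ A) * (NG ^ (V - P) * NK ^ (V - A)) := by
    intro t
    have h1 : ∫⁻ x, (g (x - t) * k x) ^ U ≤ (∫⁻ x, g (x - t) ^ P * k x ^ A) ^ (U / V) *
        (∫⁻ x, g (x - t) ^ P) ^ (U / P - U / V) * (∫⁻ x, k x ^ A) ^ (U / A - U / V) := by
      simp_rw [split]
      exact lintegral_mul_mul_rpow_le (by fun_prop) (by fun_prop) (by fun_prop) hx hy hz hsum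
    rw [lintegral_sub_right_eq_self (fun x => g x ^ P) t, ← egP, ← ekA] at h1
    rw [← ENNReal.rpow_mul, one_div_mul_eq_div]
    refine (ENNReal.rpow_le_rpow h1 hVU).trans_eq ?_
    rw [ENNReal.mul_rpow_of_nonneg _ _ hVU, ENNReal.mul_rpow_of_nonneg _ _ hVU]
    simp_rw [← ENNReal.rpow_mul]
    have e1 : U / V * (V / U) = 1 := by field_simp
    have e2 : P * (U / P - U / V) * (V / U) = V - P := by field_simp
    have e3 : A * (U / A - U / V) * (V / U) = V - A := by field_simp
    rw [e1, ENNReal.rpow_one, e2, e3, mul_assoc]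
  calc ∫⁻ t, ((∫⁻ x, (g (x - t) * k x) ^ U) ^ (1 / U)) ^ V
      ≤ ∫⁻ t, (∫⁻ x, g (x - t) ^ P * k x ^ A) * (NG ^ (V - P) * NK ^ (V - A)) :=
        lintegral_mono step
    _ = (∫⁻ t, ∫⁻ x, g (x - t) ^ P * k x ^ A) * (NG ^ (V - P) * NK ^ (V - A)) := by
        rw [lintegral_mul_const]
        exact Measurable.lintegral_prod_right'
          (f := fun q : Ed d × Ed d => g (q.2 - q.1) ^ P * k q.2 ^ A)
          (by fun_prop)
    _ = (NG ^ P * NK ^ A) * (NG ^ (V - P) * NK ^ (V - A)) := by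
        rw [lintegral_lintegral_swap (by fun_prop)]
        congr 1
        have : ∀ x, ∫⁻ t, g (x - t) ^ P * k x ^ A = NG ^ P * k x ^ A := fun x => by
          rw [lintegral_mul_const _ (by fun_prop), lintegral_sub_left_eq_self (fun t => g t ^ P) x,
            ← egP]
        simp_rw [this]
        rw [lintegral_const_mul _ (by fun_prop), ekA]
    _ = (NG * NK) ^ V := by
        rw [mul_mul_mul_comm, ← ENNReal.rpow_add_of_nonneg _ _ hp0.le (sub_nonneg.2 hvp),
          ← ENNReal.rpow_add_of_nonneg _ _ ha0.le (sub_nonneg.2 hva), add_sub_cancel,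
          add_sub_cancel, ENNReal.mul_rpow_of_nonneg _ _ hv0.le]

theorem eNorm_eNorm_mul_add_le {u v p a : ℝ≥0∞} (hu : 1 ≤ u) (hp : 1 ≤ p) (hv : 1 ≤ v)
    (ha : 1 ≤ a) (h : u⁻¹ + v⁻¹ = p⁻¹ + a⁻¹) (hvp : v⁻¹ ≤ p⁻¹) (hpu : p⁻¹ ≤ u⁻¹)
    {g k : Ed d → ℝ≥0∞} (hg : Measurable g) (hk : Measurable k) :
    eNorm volume v (fun t => eNorm volume u fun x => g x * k (t + x)) ≤
      eNorm volume p g * eNorm volume a k := by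
  refine le_of_eq_of_le ?_ (eNorm_eNorm_sub_mul_le hu hp hv ha h hvp hpu hg hk)
  congr 1 with t
  rw [← eNorm_comp_sub_right u (F := fun x => g x * k (t + x)) (by fun_prop) t]
  simp

theorem lintegral_lintegral_mul_le_mixed {β γ : Type*} [MeasurableSpace β] [MeasurableSpace γ]
    {ν : Measure β} {ρ : Measure γ} [SFinite ν] {r₁ r₂ r₁' r₂' : ℝ≥0∞} (h₁ : r₁⁻¹ + r₁'⁻¹ = 1)
    (h₂ : r₂⁻¹ + r₂'⁻¹ = 1) {F G : γ → β → ℝ≥0∞} (hF : Measurable (Function.uncurry F))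
    (hG : Measurable (Function.uncurry G)) :
    ∫⁻ z, ∫⁻ y, F z y * G z y ∂ν ∂ρ ≤
      eNorm ρ r₂ (fun z => eNorm ν r₁ (F z)) * eNorm ρ r₂' (fun z => eNorm ν r₁' (G z)) := by
  refine (lintegral_mono fun z => ?_).trans
    (lintegral_mul_le_eNorm h₂ (measurable_eNorm r₁ hF) (measurable_eNorm r₁' hG))
  exact lintegral_mul_le_eNorm h₁ hF.of_uncurry_left hG.of_uncurry_left

theorem lintegral_mul_le_mixed {α β γ : Type*} [MeasurableSpace α] [MeasurableSpace β]
    [MeasurableSpace γ] {μ : Measure α} {ν : Measure β} {ρ : Measure γ} [SFinite μ] [SFinite ν]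
    {r₀ r₁ r₂ r₀' r₁' r₂' : ℝ≥0∞} (h₀ : r₀⁻¹ + r₀'⁻¹ = 1)
    (h₁ : r₁⁻¹ + r₁'⁻¹ = 1) (h₂ : r₂⁻¹ + r₂'⁻¹ = 1) {F G : α → β → γ → ℝ≥0∞}
    (hF : Measurable fun X : α × β × γ => F X.1 X.2.1 X.2.2)
    (hG : Measurable fun X : α × β × γ => G X.1 X.2.1 X.2.2) :
    ∫⁻ z, ∫⁻ y, ∫⁻ x, F x y z * G x y z ∂μ ∂ν ∂ρ ≤
      eNorm ρ r₂ (fun z => eNorm ν r₁ fun y => eNorm μ r₀ fun x => F x y z) *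
      eNorm ρ r₂' (fun z => eNorm ν r₁' fun y => eNorm μ r₀' fun x => G x y z) := by
  have hperm : Measurable fun y : (γ × β) × α => (y.2, y.1.2, y.1.1) := by fun_prop
  have hF' : Measurable (Function.uncurry fun (q : γ × β) x => F x q.2 q.1) := hF.comp hperm
  have hG' : Measurable (Function.uncurry fun (q : γ × β) x => G x q.2 q.1) := hG.comp hperm
  have key := lintegral_lintegral_mul_le_mixed (ν := ν) (ρ := ρ) h₁ h₂
    (F := fun z y => eNorm μ r₀ fun x => F x y z) (G := fun z y => eNorm μ r₀' fun x => G x y z)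
    (measurable_eNorm r₀ hF') (measurable_eNorm r₀' hG')
  refine le_trans (lintegral_mono fun z => lintegral_mono fun y => ?_) key
  exact lintegral_mul_le_eNorm h₀ (hF'.of_uncurry_left (x := (z, y)))
    (hG'.of_uncurry_left (x := (z, y)))

theorem one_le_of_inv_le_inv {x y : ℝ≥0∞} (hy : 1 ≤ y) (h : x⁻¹ ≤ y⁻¹) : 1 ≤ x :=
  hy.trans (ENNReal.inv_le_inv.1 h)

theorem lintegral_time_le {r₀ r₁ r₂ r₀' r₁' r₂' p₁ p₂ b : ℝ≥0∞} (h₀ : r₀⁻¹ + r₀'⁻¹ = 1)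
    (h₁ : r₁⁻¹ + r₁'⁻¹ = 1) (h₂ : r₂⁻¹ + r₂'⁻¹ = 1) (hr : 1 ≤ r₀') (c₁ : r₀' ≤ p₁) (c₂ : p₁ ≤ r₁')
    (c₃ : r₁' ≤ p₂) (c₄ : p₂ ≤ r₂') (hb : 1 ≤ b)
    (hsum : r₀'⁻¹ + r₁'⁻¹ + r₂'⁻¹ = p₁⁻¹ + p₂⁻¹ + b⁻¹)
    {F : Ed d → Ed d → Ed d → ℝ≥0∞} {g₁ g₂ k : Ed d → ℝ≥0∞}
    (hF : Measurable fun X : Ed d × Ed d × Ed d => F X.1 X.2.1 X.2.2)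
    (hg₁ : Measurable g₁) (hg₂ : Measurable g₂) (hk : Measurable k) :
    ∫⁻ t₂, ∫⁻ t₁, ∫⁻ x, F x t₁ t₂ * (g₁ (x - t₁) * (g₂ (x - t₂) * k x)) ≤
      eNorm volume r₂ (fun t₂ => eNorm volume r₁ fun t₁ => eNorm volume r₀ fun x => F x t₁ t₂) *
        (eNorm volume p₁ g₁ * (eNorm volume p₂ g₂ * eNorm volume b k)) := by
  have hp₁ : 1 ≤ p₁ := hr.trans c₁
  have hr₁ : 1 ≤ r₁' := hp₁.trans c₂
  have hp₂ : 1 ≤ p₂ := hr₁.trans c₃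
  have hr₂ : 1 ≤ r₂' := hp₂.trans c₄
  have hp₁' : p₁⁻¹ ≠ ∞ := by simpa using (zero_lt_one.trans_le hp₁).ne'
  rw [← ENNReal.inv_le_inv] at c₁ c₂ c₃ c₄
  set a : ℝ≥0∞ := ((r₀'⁻¹ - p₁⁻¹) + r₁'⁻¹)⁻¹ with ha
  have ha' : a⁻¹ = (r₀'⁻¹ - p₁⁻¹) + r₁'⁻¹ := inv_inv _
  have e1 : r₀'⁻¹ + r₁'⁻¹ = p₁⁻¹ + a⁻¹ := by
    rw [ha', ← add_assoc, add_tsub_cancel_of_le c₁]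
  have e2 : a⁻¹ + r₂'⁻¹ = p₂⁻¹ + b⁻¹ := by
    rw [e1, add_assoc, add_assoc] at hsum
    exact (ENNReal.add_right_inj hp₁').1 hsum
  have har₀ : a⁻¹ ≤ r₀'⁻¹ := by
    rw [ha']
    calc r₀'⁻¹ - p₁⁻¹ + r₁'⁻¹ ≤ r₀'⁻¹ - p₁⁻¹ + p₁⁻¹ := by gcongr
      _ = r₀'⁻¹ := tsub_add_cancel_of_le c₁
  have ha1 : 1 ≤ a := one_le_of_inv_le_inv hr har₀
  refine (lintegral_mul_le_mixed h₀ h₁ h₂ hF (by fun_prop)).trans ?_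
  gcongr
  calc eNorm volume r₂' (fun t₂ => eNorm volume r₁' fun t₁ => eNorm volume r₀' fun x =>
        g₁ (x - t₁) * (g₂ (x - t₂) * k x))
      ≤ eNorm volume r₂' (fun t₂ => eNorm volume p₁ g₁ *
          eNorm volume a fun x => g₂ (x - t₂) * k x) :=
        eNorm_mono _ fun t₂ => eNorm_eNorm_sub_mul_le hr hp₁ hr₁ ha1 e1 c₂ c₁ hg₁ (by fun_prop)
    _ = eNorm volume p₁ g₁ *
          eNorm volume r₂' (fun t₂ => eNorm volume a fun x => g₂ (x - t₂) * k x) :=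
        eNorm_const_mul hr₂ _ (measurable_eNorm a (by fun_prop))
    _ ≤ _ := by
        gcongr
        exact eNorm_eNorm_sub_mul_le ha1 hp₂ hr₂ hb e2 c₄ (c₃.trans (ha' ▸ le_add_self)) hg₂ hk

theorem lintegral_freq_le {s₁ s₂ s₃ s₁' s₂' s₃' q₁ q₂ b : ℝ≥0∞} (h₁ : s₁⁻¹ + s₁'⁻¹ = 1)
    (h₂ : s₂⁻¹ + s₂'⁻¹ = 1) (h₃ : s₃⁻¹ + s₃'⁻¹ = 1) (hs : 1 ≤ s₁') (c₁ : s₁' ≤ q₁) (c₂ : q₁ ≤ s₂')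
    (c₃ : s₂' ≤ q₂) (c₄ : q₂ ≤ s₃') (hb : 1 ≤ b)
    (hsum : s₁'⁻¹ + s₂'⁻¹ + s₃'⁻¹ = q₁⁻¹ + q₂⁻¹ + b⁻¹)
    {G : Ed d → Ed d → Ed d → ℝ≥0∞} {g₁ g₂ k : Ed d → ℝ≥0∞}
    (hG : Measurable fun X : Ed d × Ed d × Ed d => G X.1 X.2.1 X.2.2)
    (hg₁ : Measurable g₁) (hg₂ : Measurable g₂) (hk : Measurable k) :
    ∫⁻ ω, k ω * ∫⁻ ξ₂, ∫⁻ ξ₁, G ξ₁ ξ₂ (ω - ξ₁ - ξ₂) * (g₁ ξ₁ * g₂ ξ₂) ≤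
      eNorm volume s₃ (fun ν => eNorm volume s₂ fun ξ₂ => eNorm volume s₁ fun ξ₁ => G ξ₁ ξ₂ ν) *
        (eNorm volume q₁ g₁ * (eNorm volume q₂ g₂ * eNorm volume b k)) := by
  have hq₁ : 1 ≤ q₁ := hs.trans c₁
  have hs₂ : 1 ≤ s₂' := hq₁.trans c₂
  have hq₂ : 1 ≤ q₂ := hs₂.trans c₃
  have hs₃ : 1 ≤ s₃' := hq₂.trans c₄
  have hq₂' : q₂⁻¹ ≠ ∞ := by simpa using (zero_lt_one.trans_le hq₂).ne'
  rw [← ENNReal.inv_le_inv] at c₁ c₂ c₃ c₄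
  set a : ℝ≥0∞ := ((s₂'⁻¹ - q₂⁻¹) + s₃'⁻¹)⁻¹ with ha
  have ha' : a⁻¹ = (s₂'⁻¹ - q₂⁻¹) + s₃'⁻¹ := inv_inv _
  have e2 : s₂'⁻¹ + s₃'⁻¹ = q₂⁻¹ + a⁻¹ := by
    rw [ha', ← add_assoc, add_tsub_cancel_of_le c₃]
  have e1 : s₁'⁻¹ + a⁻¹ = q₁⁻¹ + b⁻¹ := by
    rw [add_assoc, e2] at hsum
    refine (ENNReal.add_right_inj hq₂').1 ?_
    rw [add_left_comm, hsum]
    ring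
  have has₂ : a⁻¹ ≤ s₂'⁻¹ := by
    rw [ha']
    calc s₂'⁻¹ - q₂⁻¹ + s₃'⁻¹ ≤ s₂'⁻¹ - q₂⁻¹ + q₂⁻¹ := by gcongr
      _ = s₂'⁻¹ := tsub_add_cancel_of_le c₃
  have ha1 : 1 ≤ a := one_le_of_inv_le_inv hs₂ has₂
  have hG' : ∀ {α : Type} [MeasurableSpace α] {u v w : α → Ed d}, Measurable u → Measurable v →
      Measurable w → Measurable fun x => G (u x) (v x) (w x) := fun hu hv hw =>
    hG.comp (hu.prodMk (hv.prodMk hw))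
  have hshift : ∫⁻ ω, k ω * ∫⁻ ξ₂, ∫⁻ ξ₁, G ξ₁ ξ₂ (ω - ξ₁ - ξ₂) * (g₁ ξ₁ * g₂ ξ₂) =
      ∫⁻ ν, ∫⁻ ξ₂, ∫⁻ ξ₁, G ξ₁ ξ₂ ν * (g₂ ξ₂ * (g₁ ξ₁ * k (ν + ξ₂ + ξ₁))) := by
    have hswap : ∀ {H : Ed d → Ed d → Ed d → ℝ≥0∞},
        (Measurable fun X : Ed d × Ed d × Ed d => H X.1 X.2.1 X.2.2) →
        ∫⁻ ω, ∫⁻ ξ₂, ∫⁻ ξ₁, H ω ξ₂ ξ₁ = ∫⁻ ξ₂, ∫⁻ ξ₁, ∫⁻ ω, H ω ξ₂ ξ₁ := by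
      intro H hH
      have : Measurable fun q : (Ed d × Ed d) × Ed d => H q.1.1 q.1.2 q.2 :=
        hH.comp (by fun_prop : Measurable fun q : (Ed d × Ed d) × Ed d => (q.1.1, q.1.2, q.2))
      rw [lintegral_lintegral_swap this.lintegral_prod_right'.aemeasurable]
      refine lintegral_congr fun ξ₂ => ?_
      rw [lintegral_lintegral_swap]
      exact (hH.comp (by fun_prop :
        Measurable fun q : Ed d × Ed d => (q.1, ξ₂, q.2))).aemeasurable
    have hA : ∀ ω, k ω * ∫⁻ ξ₂, ∫⁻ ξ₁, G ξ₁ ξ₂ (ω - ξ₁ - ξ₂) * (g₁ ξ₁ * g₂ ξ₂) =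
        ∫⁻ ξ₂, ∫⁻ ξ₁, k ω * (G ξ₁ ξ₂ (ω - ξ₁ - ξ₂) * (g₁ ξ₁ * g₂ ξ₂)) := by
      intro ω
      have m : Measurable fun q : Ed d × Ed d =>
          G q.2 q.1 (ω - q.2 - q.1) * (g₁ q.2 * g₂ q.1) :=
        (hG' (by fun_prop) (by fun_prop) (by fun_prop)).mul (by fun_prop)
      rw [← lintegral_const_mul _ m.lintegral_prod_right']
      refine lintegral_congr fun ξ₂ => ?_
      exact (lintegral_const_mul (k ω)
        (m.comp (by fun_prop : Measurable fun x : Ed d => (ξ₂, x)))).symm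
    simp_rw [hA]
    rw [hswap (H := fun ω ξ₂ ξ₁ => k ω * (G ξ₁ ξ₂ (ω - ξ₁ - ξ₂) * (g₁ ξ₁ * g₂ ξ₂))),
      hswap (H := fun ν ξ₂ ξ₁ => G ξ₁ ξ₂ ν * (g₂ ξ₂ * (g₁ ξ₁ * k (ν + ξ₂ + ξ₁))))]
    · refine lintegral_congr fun ξ₂ => lintegral_congr fun ξ₁ => ?_
      rw [← lintegral_add_right_eq_self _ (ξ₂ + ξ₁)]
      refine lintegral_congr fun ν => ?_
      rw [show ν + (ξ₂ + ξ₁) - ξ₁ - ξ₂ = ν by abel, ← add_assoc]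
      ring
    · exact (hG' (by fun_prop) (by fun_prop) (by fun_prop)).mul (by fun_prop)
    · exact (hk.comp measurable_fst).mul
        ((hG' (by fun_prop) (by fun_prop) (by fun_prop)).mul (by fun_prop))
  rw [hshift]
  refine (lintegral_mul_le_mixed h₁ h₂ h₃ hG (by fun_prop)).trans ?_
  gcongr
  set H : Ed d → ℝ≥0∞ := fun τ => eNorm volume s₁' fun ξ₁ => g₁ ξ₁ * k (τ + ξ₁) with hH
  have hHm : Measurable H := measurable_eNorm s₁' (by fun_prop)
  calc eNorm volume s₃' (fun ν => eNorm volume s₂' fun ξ₂ => eNorm volume s₁' fun ξ₁ =>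
        g₂ ξ₂ * (g₁ ξ₁ * k (ν + ξ₂ + ξ₁)))
      = eNorm volume s₃' (fun ν => eNorm volume s₂' fun ξ₂ => g₂ ξ₂ * H (ν + ξ₂)) := by
        congr 1 with ν
        congr 1 with ξ₂
        exact eNorm_const_mul hs _ (by fun_prop)
    _ ≤ eNorm volume q₂ g₂ * eNorm volume a H :=
        eNorm_eNorm_mul_add_le hs₂ hq₂ hs₃ ha1 e2 c₄ c₃ hg₂ hHm
    _ ≤ eNorm volume q₂ g₂ * (eNorm volume q₁ g₁ * eNorm volume b k) := by
        gcongr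
        exact eNorm_eNorm_mul_add_le hs hq₁ ha1 hb e1 (has₂.trans c₂) c₁ hg₁ hk
    _ = _ := by ring

end Multilinear

section Gaussians

variable {d : ℕ}

theorem e2pi_add (a b : ℝ) : e2pi (a + b) = e2pi a * e2pi b := by
  rw [e2pi, e2pi, e2pi, ← Complex.exp_add]
  push_cast
  ring_nf

@[simp] theorem enorm_e2pi (a : ℝ) : ‖e2pi a‖ₑ = 1 := by
  rw [← ofReal_norm, e2pi, show 2 * (Real.pi : ℂ) * I * a = ((2 * Real.pi * a : ℝ) : ℂ) * I by
    push_cast; ring, Complex.norm_exp_ofReal_mul_I, ENNReal.ofReal_one]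

@[fun_prop] theorem continuous_e2pi : Continuous e2pi := by
  unfold e2pi
  fun_prop

@[fun_prop] theorem measurable_e2pi : Measurable e2pi := continuous_e2pi.measurable

/-- The Gaussian `e^{-M ‖z‖²}` as a complex-valued function. -/
def gaussian (d : ℕ) (M : ℝ) (z : Ed d) : ℂ := (Real.exp (-(M * ‖z‖ ^ 2)) : ℝ)

theorem gauss_eq_gaussian (d : ℕ) : gauss d = gaussian d 1 := by
  ext z
  simp [gauss, gaussian]

@[fun_prop] theorem continuous_gaussian (M : ℝ) : Continuous (gaussian d M) := by
  unfold gaussian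
  fun_prop

@[fun_prop] theorem measurable_gaussian (M : ℝ) : Measurable (gaussian d M) :=
  (continuous_gaussian M).measurable

theorem gaussian_mul (M N : ℝ) (z : Ed d) :
    gaussian d M z * gaussian d N z = gaussian d (M + N) z := by
  rw [gaussian, gaussian, gaussian, ← Complex.ofReal_mul, ← Real.exp_add]
  ring_nf

theorem gaussian_sub_comm (M : ℝ) (x y : Ed d) : gaussian d M (x - y) = gaussian d M (y - x) := by
  rw [gaussian, gaussian, norm_sub_rev]

theorem norm_gaussian (M : ℝ) (z : Ed d) : ‖gaussian d M z‖ = Real.exp (-(M * ‖z‖ ^ 2)) := by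
  rw [gaussian, Complex.norm_real, Real.norm_of_nonneg (Real.exp_pos _).le]

theorem norm_gaussian_le {M : ℝ} (hM : 0 < M) (z : Ed d) : ‖gaussian d M z‖ ≤ 1 := by
  rw [norm_gaussian, Real.exp_le_one_iff]
  simp only [Left.neg_nonpos_iff]
  positivity

theorem enorm_gaussian_le {M : ℝ} (hM : 0 < M) (z : Ed d) : ‖gaussian d M z‖ₑ ≤ 1 := by
  rw [← ofReal_norm, ← ENNReal.ofReal_one]
  exact ENNReal.ofReal_le_ofReal (norm_gaussian_le hM z)

theorem gaussian_eq_cexp (M : ℝ) (z : Ed d) : gaussian d M z = cexp (-(M : ℂ) * ‖z‖ ^ 2) := by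
  simp [gaussian]

theorem integrable_gaussian {M : ℝ} (hM : 0 < M) : Integrable (gaussian d M) := by
  have := GaussianFourier.integrable_cexp_neg_mul_sq_norm_add (b := (M : ℂ)) (by simpa using hM) 0
    (0 : Ed d)
  simpa [funext (gaussian_eq_cexp (d := d) M)] using this

theorem lintegral_gaussian_ne_top {M : ℝ} (hM : 0 < M) : ∫⁻ z, ‖gaussian d M z‖ₑ ≠ ∞ :=
  (integrable_gaussian hM).2.ne

/-- The integral of `e^{-M ‖z‖²}`. -/
def gaussianIntegral (d : ℕ) (M : ℝ) : ℂ := ∫ z, gaussian d M z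

theorem gaussianIntegral_ne_zero {M : ℝ} (hM : 0 < M) : gaussianIntegral d M ≠ 0 := by
  have : gaussianIntegral d M = (Real.pi / M : ℂ) ^ (Module.finrank ℝ (Ed d) / 2 : ℂ) := by
    rw [gaussianIntegral, funext (gaussian_eq_cexp (d := d) M)]
    exact GaussianFourier.integral_cexp_neg_mul_sq_norm (by simpa using hM)
  rw [this, Complex.cpow_ne_zero_iff]
  left
  exact div_ne_zero (by simp [Real.pi_ne_zero]) (by simpa using hM.ne')

theorem integral_gaussian_mul_e2pi {M : ℝ} (hM : 0 < M) (v : Ed d) :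
    ∫ a, gaussian d M a * e2pi ⟪v, a⟫ =
      gaussianIntegral d M * gaussian d (Real.pi ^ 2 / M) v := by
  have h1 := GaussianFourier.integral_cexp_neg_mul_sq_norm_add (b := (M : ℂ)) (by simpa using hM)
    (2 * Real.pi * I) v
  have h0 := GaussianFourier.integral_cexp_neg_mul_sq_norm_add (b := (M : ℂ)) (by simpa using hM)
    0 (0 : Ed d)
  simp only [zero_mul, add_zero, norm_zero, ofReal_zero, ne_eq, OfNat.ofNat_ne_zero,
    not_false_eq_true, zero_pow, mul_zero, zero_div, Complex.exp_zero, mul_one] at h0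
  simp_rw [gaussianIntegral, gaussian_eq_cexp, h0, e2pi, ← Complex.exp_add, h1]
  congr 2
  rw [mul_pow, I_sq]
  push_cast
  have : (M : ℂ) ≠ 0 := by simpa using hM.ne'
  field_simp
  ring

/-- Fourier transform of a product of two shifted Gaussians. -/
theorem integral_gaussian_mul_gaussian_sub_mul_e2pi {M N : ℝ} (h : 0 < M + N)
    (ζ v : Ed d) :
    ∫ a, gaussian d M a * gaussian d N (ζ - a) * e2pi ⟪v, a⟫ =
      gaussianIntegral d (M + N) * gaussian d (M * N / (M + N)) ζ *
        gaussian d (Real.pi ^ 2 / (M + N)) v * e2pi (N / (M + N) * ⟪v, ζ⟫) := by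
  rw [← integral_add_right_eq_self _ ((N / (M + N)) • ζ)]
  have : ∀ a : Ed d, gaussian d M (a + (N / (M + N)) • ζ) *
      gaussian d N (ζ - (a + (N / (M + N)) • ζ)) * e2pi ⟪v, a + (N / (M + N)) • ζ⟫ =
      (gaussian d (M + N) a * e2pi ⟪v, a⟫) *
        (gaussian d (M * N / (M + N)) ζ * e2pi (N / (M + N) * ⟪v, ζ⟫)) := by
    intro a
    have e : gaussian d M (a + (N / (M + N)) • ζ) * gaussian d N (ζ - (a + (N / (M + N)) • ζ)) =
        gaussian d (M + N) a * gaussian d (M * N / (M + N)) ζ := by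
      simp only [gaussian]
      rw [← ofReal_mul, ← ofReal_mul, ← Real.exp_add, ← Real.exp_add]
      congr 2
      have e1 : ζ - (a + (N / (M + N)) • ζ) = (M / (M + N)) • ζ - a := by
        rw [show M / (M + N) = 1 - N / (M + N) by field_simp; ring, sub_smul, one_smul]
        abel
      rw [e1, norm_add_sq_real, norm_sub_sq_real, norm_smul, norm_smul, mul_pow, mul_pow,
        Real.norm_eq_abs, Real.norm_eq_abs, sq_abs, sq_abs, inner_smul_right,
        real_inner_smul_left, real_inner_comm]
      field_simp
      ring
    rw [e, inner_add_right, inner_smul_right, e2pi_add]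
    ring
  simp_rw [this]
  rw [integral_mul_const, integral_gaussian_mul_e2pi h]
  ring

end Gaussians

section Insertion

variable {α β : Type*} [MeasurableSpace α] [MeasurableSpace β] {μ : Measure α} {ν : Measure β}

theorem integrable_mul_of_lintegral_le [SFinite ν] {m : α → ℂ} {w : α → β → ℂ}
    (hm : Integrable m μ) (hw : Measurable (Function.uncurry w)) {K : ℝ≥0∞} (hK : K ≠ ∞)
    (h : ∀ x, ∫⁻ y, ‖w x y‖ₑ ∂ν ≤ K) :
    Integrable (fun q : α × β => m q.1 * w q.1 q.2) (μ.prod ν) := by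
  have hmeas : AEStronglyMeasurable (fun q : α × β => m q.1 * w q.1 q.2) (μ.prod ν) :=
    hm.1.comp_fst.mul hw.aestronglyMeasurable
  refine ⟨hmeas, ?_⟩
  rw [HasFiniteIntegral, lintegral_prod _ hmeas.enorm]
  simp_rw [enorm_mul]
  calc ∫⁻ x, ∫⁻ y, ‖m x‖ₑ * ‖w x y‖ₑ ∂ν ∂μ ≤ ∫⁻ x, ‖m x‖ₑ * K ∂μ := by
        refine lintegral_mono fun x => ?_
        rw [lintegral_const_mul _ (by fun_prop)]
        gcongr
        exact h x
    _ = (∫⁻ x, ‖m x‖ₑ ∂μ) * K := lintegral_mul_const' _ _ hK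
    _ < ∞ := ENNReal.mul_lt_top hm.2 hK.lt_top

theorem enorm_integral_mul_integral_le [SFinite μ] [SFinite ν] {m : α → ℂ} {w : α → β → ℂ}
    (hm : Integrable m μ) (hw : Measurable (Function.uncurry w)) {K : ℝ≥0∞} (hK : K ≠ ∞)
    (h : ∀ x, ∫⁻ y, ‖w x y‖ₑ ∂ν ≤ K) :
    ‖∫ x, m x * ∫ y, w x y ∂ν ∂μ‖ₑ ≤ ∫⁻ y, ‖∫ x, m x * w x y ∂μ‖ₑ ∂ν := by
  simp_rw [← integral_const_mul]
  rw [integral_integral_swap (f := fun x y => m x * w x y)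
    (integrable_mul_of_lintegral_le hm hw hK h)]
  exact enorm_integral_le_lintegral_enorm _

theorem enorm_integral_integral_mul_le [SFinite μ] [SFinite ν] {m : β → ℂ} {w : β → α → ℂ}
    (hm : Integrable m ν) (hw : Measurable (Function.uncurry w)) {K : ℝ≥0∞} (hK : K ≠ ∞)
    (h : ∀ y, ∫⁻ x, ‖w y x‖ₑ ∂μ ≤ K) :
    ‖∫ x, ∫ y, m y * w y x ∂ν ∂μ‖ₑ ≤ ∫⁻ y, ‖m y‖ₑ * ‖∫ x, w y x ∂μ‖ₑ ∂ν := by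
  rw [← integral_integral_swap (f := fun y x => m y * w y x)
    (integrable_mul_of_lintegral_le hm hw hK h)]
  refine (enorm_integral_le_lintegral_enorm _).trans_eq ?_
  simp_rw [integral_const_mul, enorm_mul]

end Insertion

section Smoothing

variable {d : ℕ}

theorem lintegral_gaussian_sub (M : ℝ) (x : Ed d) :
    ∫⁻ y, ‖gaussian d M (y - x)‖ₑ = ∫⁻ y, ‖gaussian d M y‖ₑ :=
  lintegral_sub_right_eq_self (fun y => ‖gaussian d M y‖ₑ) x

theorem lintegral_gaussian_sub_left (M : ℝ) (x : Ed d) :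
    ∫⁻ y, ‖gaussian d M (x - y)‖ₑ = ∫⁻ y, ‖gaussian d M y‖ₑ :=
  lintegral_sub_left_eq_self (fun y => ‖gaussian d M y‖ₑ) x

theorem gaussian_apply_zero (M : ℝ) : gaussian d M 0 = 1 := by simp [gaussian]

theorem e2pi_zero : e2pi 0 = 1 := by simp [e2pi]

theorem enorm_STFT_le_lintegral_time {T : Ed d → ℂ} (hT : Measurable T) {B : ℝ≥0∞} (hB : B ≠ ∞)
    (hTB : ∀ y, ‖T y‖ₑ ≤ B) {M N : ℝ} (hM : 0 < M) (hN : 0 < N) (x ω : Ed d) :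
    ‖gaussianIntegral d (M + N)‖ₑ * ‖STFT d (gaussian d (M * N / (M + N))) T x ω‖ₑ ≤
      ∫⁻ w, ‖gaussian d M w‖ₑ * ‖STFT d (gaussian d N) T (x + w) ω‖ₑ := by
  have key := enorm_integral_integral_mul_le (μ := volume) (integrable_gaussian (d := d) hM)
    (w := fun a y => T y * e2pi (-⟪y, ω⟫) * gaussian d N (y - (x + a)))
    (by fun_prop) (ENNReal.mul_ne_top hB (lintegral_gaussian_ne_top (d := d) hN)) (fun a => by
      rw [← lintegral_gaussian_sub N (x + a), ← lintegral_const_mul _ (by fun_prop)]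
      refine lintegral_mono fun y => ?_
      rw [enorm_mul, enorm_mul, enorm_e2pi, mul_one]
      gcongr
      exact hTB y)
  refine le_of_eq_of_le ?_ key
  rw [← enorm_mul, STFT, ← integral_const_mul]
  congr 2 with y
  have h := integral_gaussian_mul_gaussian_sub_mul_e2pi (add_pos hM hN) (y - x) 0
  simp only [inner_zero_left, mul_zero, e2pi_zero, mul_one, gaussian_apply_zero] at h
  calc _ = T y * e2pi (-⟪y, ω⟫) *
        (gaussianIntegral d (M + N) * gaussian d (M * N / (M + N)) (y - x)) := by ring
    _ = _ := by
      rw [← h, ← integral_const_mul]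
      congr 1 with a
      rw [sub_add_eq_sub_sub]
      ring

theorem enorm_STFT_le_lintegral_freq {T : Ed d → ℂ} (hT : Measurable T) {B : ℝ≥0∞} (hB : B ≠ ∞)
    (hTB : ∀ y, ‖T y‖ₑ ≤ B) {N : ℝ} (hN : 0 < N) (x ω : Ed d) :
    ‖gaussianIntegral d 1‖ₑ * ‖STFT d (gaussian d (N + Real.pi ^ 2)) T x ω‖ₑ ≤
      ∫⁻ b, ‖gaussian d 1 b‖ₑ * ‖STFT d (gaussian d N) T x (ω - b)‖ₑ := by
  have key := enorm_integral_integral_mul_le (μ := volume)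
    (integrable_gaussian (d := d) one_pos)
    (w := fun b y => T y * e2pi (-⟪y, ω⟫) * gaussian d N (y - x) * e2pi ⟪y - x, b⟫)
    (by fun_prop) (ENNReal.mul_ne_top hB (lintegral_gaussian_ne_top (d := d) hN)) (fun b => by
      rw [← lintegral_gaussian_sub N x, ← lintegral_const_mul _ (by fun_prop)]
      refine lintegral_mono fun y => ?_
      rw [enorm_mul, enorm_mul, enorm_mul, enorm_e2pi, enorm_e2pi, mul_one, mul_one]
      gcongr
      exact hTB y)
  refine le_of_eq_of_le ?_ (key.trans_eq ?_)
  · rw [← enorm_mul, STFT, ← integral_const_mul]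
    congr 2 with y
    have h := integral_gaussian_mul_e2pi one_pos (y - x)
    rw [div_one] at h
    rw [← gaussian_mul]
    calc _ = T y * e2pi (-⟪y, ω⟫) * gaussian d N (y - x) *
          (gaussianIntegral d 1 * gaussian d (Real.pi ^ 2) (y - x)) := by ring
      _ = _ := by
        rw [← h, ← integral_const_mul]
        congr 1 with a
        ring
  · refine lintegral_congr fun b => ?_
    congr 1
    rw [STFT, ← one_mul ‖∫ y, T y * e2pi (-⟪y, ω - b⟫) * _‖ₑ, ← enorm_e2pi (-⟪x, b⟫), ← enorm_mul,
      ← integral_const_mul]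
    congr 2 with y
    rw [inner_sub_left, inner_sub_right, sub_eq_add_neg ⟪y, b⟫, e2pi_add,
      show -(⟪y, ω⟫ - ⟪y, b⟫) = -⟪y, ω⟫ + ⟪y, b⟫ by ring, e2pi_add]
    ring

theorem integral_STFT_mul_e2pi {f : Ed d → ℂ} (hf : Integrable f) (ξ η : Ed d) :
    ∫ t, STFT d (gauss d) f t ξ * e2pi (-⟪t, η - ξ⟫) =
      gaussianIntegral d 1 * gaussian d (Real.pi ^ 2) (η - ξ) * FT d f η := by
  have h_int := integrable_mul_of_lintegral_le (ν := (volume : Measure (Ed d))) hf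
    (w := fun y t => e2pi (-⟪y, ξ⟫) * gaussian d 1 (y - t) * e2pi (-⟪t, η - ξ⟫))
    (by fun_prop) (lintegral_gaussian_ne_top (d := d) one_pos) (fun y => by
      simp_rw [enorm_mul, enorm_e2pi, one_mul, mul_one]
      rw [lintegral_gaussian_sub_left])
  have hswap := integral_integral_swap (f := fun y t =>
    f y * (e2pi (-⟪y, ξ⟫) * gaussian d 1 (y - t) * e2pi (-⟪t, η - ξ⟫))) h_int
  calc _ = ∫ t, ∫ y, f y * (e2pi (-⟪y, ξ⟫) * gaussian d 1 (y - t) * e2pi (-⟪t, η - ξ⟫)) := by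
        congr 1 with t
        rw [STFT, ← integral_mul_const, gauss_eq_gaussian]
        congr 1 with y
        ring
    _ = _ := hswap.symm
    _ = ∫ y, gaussianIntegral d 1 * gaussian d (Real.pi ^ 2) (η - ξ) * (f y * e2pi (-⟪y, η⟫)) := by
        congr 1 with y
        have h := integral_gaussian_mul_e2pi one_pos (η - ξ)
        rw [div_one] at h
        rw [← h, integral_const_mul, ← integral_sub_left_eq_self _ volume y,
          mul_left_comm,
          mul_comm (∫ a, _), ← integral_const_mul (e2pi _)]
        refine congrArg (f y * ·) (integral_congr_ae (.of_forall fun t => ?_))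
        simp only [sub_sub_cancel]
        have : e2pi (-⟪y, ξ⟫) * e2pi (-⟪y - t, η - ξ⟫) = e2pi (-⟪y, η⟫) * e2pi ⟪η - ξ, t⟫ := by
          rw [← e2pi_add, ← e2pi_add, real_inner_comm t (η - ξ)]
          congr 1
          simp only [inner_sub_left, inner_sub_right]
          ring
        linear_combination gaussian d 1 t * this
    _ = _ := integral_const_mul _ _

theorem lintegral_STFT_ne_top {f : Ed d → ℂ} (hf : Integrable f) (hf' : Measurable f) (ξ : Ed d) :
    ∫⁻ t, ‖STFT d (gauss d) f t ξ‖ₑ ≠ ∞ := by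
  refine ne_top_of_le_ne_top (ENNReal.mul_ne_top hf.2.ne
    (lintegral_gaussian_ne_top (d := d) one_pos)) ?_
  calc ∫⁻ t, ‖STFT d (gauss d) f t ξ‖ₑ ≤ ∫⁻ t, ∫⁻ y, ‖f y‖ₑ * ‖gaussian d 1 (y - t)‖ₑ := by
        refine lintegral_mono fun t => (enorm_integral_le_lintegral_enorm _).trans_eq ?_
        simp_rw [enorm_mul, enorm_e2pi, mul_one, gauss_eq_gaussian]
    _ = ∫⁻ y, ∫⁻ t, ‖f y‖ₑ * ‖gaussian d 1 (y - t)‖ₑ := lintegral_lintegral_swap (by fun_prop)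
    _ = (∫⁻ y, ‖f y‖ₑ) * ∫⁻ z, ‖gaussian d 1 z‖ₑ := by
        rw [← lintegral_mul_const _ (by fun_prop)]
        refine lintegral_congr fun y => ?_
        rw [lintegral_const_mul _ (by fun_prop), lintegral_gaussian_sub_left]
    _ ≤ _ := le_rfl

theorem measurable_STFT {φ f : Ed d → ℂ} (hφ : Measurable φ) (hf : Measurable f) :
    Measurable (Function.uncurry (STFT d φ f)) := by
  have : Measurable (Function.uncurry fun (q : Ed d × Ed d) y =>
      f y * e2pi (-⟪y, q.2⟫) * φ (y - q.1)) := by fun_prop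
  exact this.stronglyMeasurable.integral_prod_right.measurable

theorem measurable_FT {f : Ed d → ℂ} (hf : Measurable f) : Measurable (FT d f) := by
  have : Measurable (Function.uncurry fun (ξ : Ed d) y => f y * e2pi (-⟪y, ξ⟫)) := by fun_prop
  exact this.stronglyMeasurable.integral_prod_right.measurable

theorem FT_eq_fourier (f : Ed d → ℂ) : FT d f = FourierTransform.fourier f := by
  ext ξ
  rw [Real.fourier_eq', FT]
  congr 1 with y
  rw [e2pi, smul_eq_mul, mul_comm]
  congr 2
  push_cast
  ring

end Smoothing

section Pointwise

variable {d : ℕ}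

theorem lintegral_prod_mul_enorm {f g : Ed d → ℂ} (hf : Measurable f) (hg : Measurable g) :
    ∫⁻ q : Ed d × Ed d, ‖f q.1‖ₑ * ‖g q.2‖ₑ = (∫⁻ y, ‖f y‖ₑ) * ∫⁻ y, ‖g y‖ₑ :=
  lintegral_prod_mul (f := fun y => ‖f y‖ₑ) (g := fun y => ‖g y‖ₑ) (by fun_prop) (by fun_prop)

theorem integral_gaussian_chirp (z ζ₁ ζ₂ : Ed d) :
    ∫ a : Ed d × Ed d, gaussian d 1 a.1 * gaussian d 1 a.2 *
      (gaussian d 1 z * gaussian d 1 (ζ₁ - a.1) * gaussian d 1 (ζ₂ - a.2) *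
        e2pi (⟪(2 : ℝ) • z, a.1⟫ + ⟪(2 : ℝ) • z, a.2⟫)) =
      gaussianIntegral d 2 ^ 2 * (gaussian d (1 + 4 * Real.pi ^ 2) z * gaussian d (1 / 2) ζ₁ *
        gaussian d (1 / 2) ζ₂ * e2pi (⟪z, ζ₁⟫ + ⟪z, ζ₂⟫)) := by
  have h : ∀ ζ, ∫ a, gaussian d 1 a * gaussian d 1 (ζ - a) * e2pi ⟪(2 : ℝ) • z, a⟫ =
      gaussianIntegral d 2 * gaussian d (1 / 2) ζ * gaussian d (2 * Real.pi ^ 2) z *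
        e2pi ⟪z, ζ⟫ := by
    intro ζ
    rw [integral_gaussian_mul_gaussian_sub_mul_e2pi (by norm_num)]
    have e : gaussian d (Real.pi ^ 2 / (1 + 1)) ((2 : ℝ) • z) = gaussian d (2 * Real.pi ^ 2) z := by
      rw [gaussian, gaussian, norm_smul, Real.norm_eq_abs, mul_pow, sq_abs]
      ring_nf
    rw [e, real_inner_smul_left, ← mul_assoc (1 / (1 + 1) : ℝ)]
    norm_num
  have hg : gaussian d (1 + 4 * Real.pi ^ 2) z =
      gaussian d 1 z * gaussian d (2 * Real.pi ^ 2) z * gaussian d (2 * Real.pi ^ 2) z := by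
    rw [gaussian_mul, gaussian_mul]
    ring_nf
  rw [hg, e2pi_add, Measure.volume_eq_prod]
  have hp := integral_prod_mul (μ := (volume : Measure (Ed d))) (ν := (volume : Measure (Ed d)))
    (fun a => gaussian d 1 a * gaussian d 1 (ζ₁ - a) * e2pi ⟪(2 : ℝ) • z, a⟫)
    (fun a => gaussian d 1 a * gaussian d 1 (ζ₂ - a) * e2pi ⟪(2 : ℝ) • z, a⟫)
  rw [h, h] at hp
  calc _ = gaussian d 1 z * ∫ a : Ed d × Ed d,
        (gaussian d 1 a.1 * gaussian d 1 (ζ₁ - a.1) * e2pi ⟪(2 : ℝ) • z, a.1⟫) *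
        (gaussian d 1 a.2 * gaussian d 1 (ζ₂ - a.2) * e2pi ⟪(2 : ℝ) • z, a.2⟫)
        ∂(volume.prod volume) := by
        rw [← integral_const_mul]
        congr 1 with a
        rw [e2pi_add]
        ring
    _ = _ := by
        rw [hp]
        ring

theorem lintegral_gaussian_triple {M N : ℝ} (x ξ₁ ξ₂ : Ed d) :
    ∫⁻ X : Ed d × Ed d × Ed d, ‖gaussian d M (X.1 - x)‖ₑ *
        (‖gaussian d N (X.2.1 - ξ₁)‖ₑ * ‖gaussian d N (X.2.2 - ξ₂)‖ₑ) =
      (∫⁻ y, ‖gaussian d M y‖ₑ) * ((∫⁻ y, ‖gaussian d N y‖ₑ) * ∫⁻ y, ‖gaussian d N y‖ₑ) := by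
  rw [Measure.volume_eq_prod, lintegral_prod_mul (f := fun y => ‖gaussian d M (y - x)‖ₑ)
    (g := fun q : Ed d × Ed d => ‖gaussian d N (q.1 - ξ₁)‖ₑ * ‖gaussian d N (q.2 - ξ₂)‖ₑ)
    (by fun_prop) (by fun_prop), lintegral_gaussian_sub,
    lintegral_prod_mul_enorm (f := fun y => gaussian d N (y - ξ₁))
      (g := fun y => gaussian d N (y - ξ₂)) (by fun_prop) (by fun_prop),
    lintegral_gaussian_sub, lintegral_gaussian_sub]

theorem enorm_integral_le_lintegral_symbSTFT {σ : Ed d × Ed d × Ed d → ℂ} (hσ : Measurable σ)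
    {B : ℝ≥0∞} (hB : B ≠ ∞) (hσB : ∀ X, ‖σ X‖ₑ ≤ B) (x ω t₁ t₂ ξ₁ ξ₂ : Ed d) :
    ‖gaussianIntegral d 2 ^ 2‖ₑ * ‖∫ X : Ed d × Ed d × Ed d,
        σ X * (gaussian d (1 + 4 * Real.pi ^ 2) (X.1 - x) * e2pi ⟪X.1, X.2.1 + X.2.2 - ω⟫ *
          (gaussian d (1 / 2) (X.2.1 - ξ₁) * gaussian d (1 / 2) (X.2.2 - ξ₂))) *
          (e2pi (-⟪t₁, X.2.1 - ξ₁⟫) * e2pi (-⟪t₂, X.2.2 - ξ₂⟫))‖ₑ ≤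
      ∫⁻ a : Ed d × Ed d, ‖gaussian d 1 a.1‖ₑ * ‖gaussian d 1 a.2‖ₑ *
        ‖symbSTFT d (gauss3 d) σ x (x - t₁) (x - t₂) (ξ₁ + a.1) (ξ₂ + a.2)
          (ω - ξ₁ - ξ₂ - (2 : ℝ) • (a.1 + a.2))‖ₑ := by
  set ph : Ed d × Ed d × Ed d → ℝ := fun X => -(⟪X.1 - x, X.2.1 - ξ₁⟫ + ⟪X.1 - x, X.2.2 - ξ₂⟫) +
    (⟪X.1, X.2.1 + X.2.2 - ω⟫ + (-⟪t₁, X.2.1 - ξ₁⟫ + -⟪t₂, X.2.2 - ξ₂⟫)) with hph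
  set w : Ed d × Ed d → Ed d × Ed d × Ed d → ℂ := fun a X => σ X *
    (gaussian d 1 (X.1 - x) * gaussian d 1 (X.2.1 - ξ₁ - a.1) * gaussian d 1 (X.2.2 - ξ₂ - a.2) *
      e2pi (⟪(2 : ℝ) • (X.1 - x), a.1⟫ + ⟪(2 : ℝ) • (X.1 - x), a.2⟫)) * e2pi (ph X) with hw
  have hwm : Measurable (Function.uncurry w) := by
    rw [hw, hph]
    fun_prop
  have key := enorm_integral_integral_mul_le (μ := (volume : Measure (Ed d × Ed d × Ed d)))
    (ν := (volume : Measure (Ed d × Ed d)))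
    ((integrable_gaussian (d := d) one_pos).mul_prod (integrable_gaussian (d := d) one_pos))
    hwm (ENNReal.mul_ne_top hB (ENNReal.mul_ne_top (lintegral_gaussian_ne_top (d := d) one_pos)
      (ENNReal.mul_ne_top (lintegral_gaussian_ne_top (d := d) one_pos)
      (lintegral_gaussian_ne_top (d := d) one_pos)))) (fun a => by
      rw [← lintegral_gaussian_triple x (ξ₁ + a.1) (ξ₂ + a.2),
        ← lintegral_const_mul _ (by fun_prop)]
      refine lintegral_mono fun X => ?_
      simp only [hw, enorm_mul, enorm_e2pi, mul_one, sub_add_eq_sub_sub, mul_assoc]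
      gcongr
      exact hσB X)
  refine le_of_eq_of_le ?_ (key.trans_eq ?_)
  · rw [← enorm_mul, ← integral_const_mul]
    congr 2 with X
    have h := integral_gaussian_chirp (X.1 - x) (X.2.1 - ξ₁) (X.2.2 - ξ₂)
    have hl : ∫ a : Ed d × Ed d, gaussian d 1 a.1 * gaussian d 1 a.2 * w a X =
        σ X * e2pi (ph X) * (gaussianIntegral d 2 ^ 2 *
          (gaussian d (1 + 4 * Real.pi ^ 2) (X.1 - x) *
          gaussian d (1 / 2) (X.2.1 - ξ₁) * gaussian d (1 / 2) (X.2.2 - ξ₂) *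
          e2pi (⟪X.1 - x, X.2.1 - ξ₁⟫ + ⟪X.1 - x, X.2.2 - ξ₂⟫))) := by
      rw [← h, ← integral_const_mul]
      congr 1 with a
      simp only [hw]
      ring
    rw [hl]
    have hp : e2pi (ph X) * e2pi (⟪X.1 - x, X.2.1 - ξ₁⟫ + ⟪X.1 - x, X.2.2 - ξ₂⟫) =
        e2pi ⟪X.1, X.2.1 + X.2.2 - ω⟫ * (e2pi (-⟪t₁, X.2.1 - ξ₁⟫) * e2pi (-⟪t₂, X.2.2 - ξ₂⟫)) := by
      rw [← e2pi_add, ← e2pi_add, ← e2pi_add]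
      congr 1
      simp only [hph]
      ring
    linear_combination -(σ X * gaussianIntegral d 2 ^ 2 *
          gaussian d (1 + 4 * Real.pi ^ 2) (X.1 - x) *
          gaussian d (1 / 2) (X.2.1 - ξ₁) * gaussian d (1 / 2) (X.2.2 - ξ₂)) * hp
  · refine lintegral_congr fun a => ?_
    rw [enorm_mul]
    congr 1
    set c : ℝ := -((2 : ℝ) * ⟪x, a.1 + a.2⟫) - ⟪x, ξ₁ + ξ₂⟫ + ⟪t₁, ξ₁⟫ + ⟪t₂, ξ₂⟫ with hc
    rw [← one_mul ‖symbSTFT _ _ _ _ _ _ _ _ _‖ₑ, ← enorm_e2pi c, ← enorm_mul, symbSTFT,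
      ← integral_const_mul]
    congr 2 with X
    simp only [hw]
    have hg : gauss3 d (X.1 - x, X.2.1 - (ξ₁ + a.1), X.2.2 - (ξ₂ + a.2)) =
        gaussian d 1 (X.1 - x) * gaussian d 1 (X.2.1 - ξ₁ - a.1) *
          gaussian d 1 (X.2.2 - ξ₂ - a.2) := by
      simp only [gauss3, gaussian, sub_add_eq_sub_sub, ← ofReal_mul, ← Real.exp_add]
      ring_nf
    have hp : e2pi (⟪(2 : ℝ) • (X.1 - x), a.1⟫ + ⟪(2 : ℝ) • (X.1 - x), a.2⟫) * e2pi (ph X) =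
        e2pi c * e2pi (-(⟪X.1, ω - ξ₁ - ξ₂ - (2 : ℝ) • (a.1 + a.2)⟫ - ⟪x - t₁, X.2.1⟫ -
          ⟪x - t₂, X.2.2⟫)) := by
      rw [← e2pi_add, ← e2pi_add]
      congr 1
      simp only [hph, hc, inner_sub_left, inner_sub_right, inner_add_right, inner_smul_right,
        real_inner_smul_left]
      ring
    rw [hg]
    linear_combination (σ X * gaussian d 1 (X.1 - x) * gaussian d 1 (X.2.1 - ξ₁ - a.1) *
          gaussian d 1 (X.2.2 - ξ₂ - a.2)) * hp

end Pointwise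

section Decomposition

variable {d : ℕ}

theorem integrable_of_enorm_le_mul {α : Type*} [MeasurableSpace α] {μ : Measure α} {F G : α → ℂ}
    {B : ℝ≥0∞} (hB : B ≠ ∞) (hF : AEStronglyMeasurable F μ) (hG : ∫⁻ a, ‖G a‖ₑ ∂μ ≠ ∞)
    (h : ∀ a, ‖F a‖ₑ ≤ B * ‖G a‖ₑ) : Integrable F μ := by
  refine ⟨hF, ((lintegral_mono h).trans_lt ?_)⟩
  rw [lintegral_const_mul' _ _ hB]
  exact ENNReal.mul_lt_top hB.lt_top hG.lt_top

theorem enorm_integral_le_lintegral_STFT {m : Ed d × Ed d × Ed d → ℂ} (hm : Integrable m)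
    {f₁ f₂ : Ed d → ℂ} (hf₁ : Integrable f₁) (hf₁' : Measurable f₁) (hf₂ : Integrable f₂)
    (hf₂' : Measurable f₂) (ξ₁ ξ₂ : Ed d) :
    ‖∫ X, m X * ((gaussianIntegral d 1 * gaussian d (Real.pi ^ 2) (X.2.1 - ξ₁) * FT d f₁ X.2.1) *
          (gaussianIntegral d 1 * gaussian d (Real.pi ^ 2) (X.2.2 - ξ₂) * FT d f₂ X.2.2))‖ₑ ≤
      ∫⁻ t : Ed d × Ed d, ‖STFT d (gauss d) f₁ t.1 ξ₁‖ₑ * ‖STFT d (gauss d) f₂ t.2 ξ₂‖ₑ *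
        ‖∫ X, m X * (e2pi (-⟪t.1, X.2.1 - ξ₁⟫) * e2pi (-⟪t.2, X.2.2 - ξ₂⟫))‖ₑ := by
  have hg : Measurable (gauss d) := by rw [gauss_eq_gaussian]; fun_prop
  obtain ⟨V₁, hV₁⟩ : ∃ V : Ed d → ℂ, V = fun t => STFT d (gauss d) f₁ t ξ₁ := ⟨_, rfl⟩
  obtain ⟨V₂, hV₂⟩ : ∃ V : Ed d → ℂ, V = fun t => STFT d (gauss d) f₂ t ξ₂ := ⟨_, rfl⟩
  have hV₁m : Measurable V₁ := hV₁ ▸ (measurable_STFT hg hf₁').of_uncurry_right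
  have hV₂m : Measurable V₂ := hV₂ ▸ (measurable_STFT hg hf₂').of_uncurry_right
  have hK₁ := lintegral_STFT_ne_top hf₁ hf₁' ξ₁
  have hK₂ := lintegral_STFT_ne_top hf₂ hf₂' ξ₂
  have hI₁ := integral_STFT_mul_e2pi hf₁ ξ₁
  have hI₂ := integral_STFT_mul_e2pi hf₂ ξ₂
  simp only [← congrFun hV₁, ← congrFun hV₂] at hK₁ hK₂ hI₁ hI₂ ⊢
  have key := enorm_integral_mul_integral_le (ν := (volume : Measure (Ed d × Ed d))) hm
    (w := fun X t => (V₁ t.1 * e2pi (-⟪t.1, X.2.1 - ξ₁⟫)) * (V₂ t.2 * e2pi (-⟪t.2, X.2.2 - ξ₂⟫)))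
    (by fun_prop) (ENNReal.mul_ne_top hK₁ hK₂)
    (fun X => by
      simp_rw [enorm_mul, enorm_e2pi, mul_one]
      exact (lintegral_prod_mul_enorm hV₁m hV₂m).le)
  refine le_of_eq_of_le ?_ (key.trans_eq ?_)
  · congr 2 with X
    congr 1
    rw [← hI₁, ← hI₂]
    exact (integral_prod_mul (fun t => V₁ t * e2pi (-⟪t, X.2.1 - ξ₁⟫))
      (fun t => V₂ t * e2pi (-⟪t, X.2.2 - ξ₂⟫))).symm
  · refine lintegral_congr fun t => ?_
    rw [← enorm_mul, ← enorm_mul, ← integral_const_mul]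
    congr 2 with X
    ring

theorem integrable_symbol_mul_gaussian {σ : Ed d × Ed d × Ed d → ℂ} (hσ : Measurable σ)
    {B : ℝ≥0∞} (hB : B ≠ ∞) (hσB : ∀ X, ‖σ X‖ₑ ≤ B) {M N : ℝ} (hM : 0 < M) (hN : 0 < N)
    (x ω ξ₁ ξ₂ : Ed d) :
    Integrable fun X : Ed d × Ed d × Ed d =>
      σ X * (gaussian d M (X.1 - x) * e2pi ⟪X.1, X.2.1 + X.2.2 - ω⟫ *
          (gaussian d N (X.2.1 - ξ₁) * gaussian d N (X.2.2 - ξ₂))) := by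
  refine integrable_of_enorm_le_mul (G := fun X => gaussian d M (X.1 - x) *
    (gaussian d N (X.2.1 - ξ₁) * gaussian d N (X.2.2 - ξ₂))) hB (by fun_prop) ?_ fun X => ?_
  · simp_rw [enorm_mul]
    rw [lintegral_gaussian_triple]
    exact ENNReal.mul_ne_top (lintegral_gaussian_ne_top hM)
      (ENNReal.mul_ne_top (lintegral_gaussian_ne_top hN) (lintegral_gaussian_ne_top hN))
  · simp only [enorm_mul, enorm_e2pi, mul_one]
    gcongr
    exact hσB X

theorem enorm_STFT_biOp_le {σ : Ed d × Ed d × Ed d → ℂ} (hσ : Measurable σ)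
    {B : ℝ≥0∞} (hB : B ≠ ∞) (hσB : ∀ X, ‖σ X‖ₑ ≤ B) {f₁ f₂ : Ed d → ℂ} (hf₁ : Integrable (FT d f₁))
    (hf₁' : Measurable f₁) (hf₂ : Integrable (FT d f₂)) (hf₂' : Measurable f₂) (x ω : Ed d) :
    ‖gaussianIntegral d 1 ^ 2 * gaussianIntegral d (1 / 2 + Real.pi ^ 2) ^ 2‖ₑ *
      ‖STFT d (gaussian d (1 + 4 * Real.pi ^ 2)) (biOp d σ f₁ f₂) x ω‖ₑ ≤
    ∫⁻ ξ : Ed d × Ed d, ‖∫ X : Ed d × Ed d × Ed d,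
        σ X * (gaussian d (1 + 4 * Real.pi ^ 2) (X.1 - x) * e2pi ⟪X.1, X.2.1 + X.2.2 - ω⟫ *
          (gaussian d (1 / 2) (X.2.1 - ξ.1) * gaussian d (1 / 2) (X.2.2 - ξ.2))) *
          ((gaussianIntegral d 1 * gaussian d (Real.pi ^ 2) (X.2.1 - ξ.1) * FT d f₁ X.2.1) *
          (gaussianIntegral d 1 * gaussian d (Real.pi ^ 2) (X.2.2 - ξ.2) * FT d f₂ X.2.2))‖ₑ := by
  have hF₁ := measurable_FT hf₁'
  have hF₂ := measurable_FT hf₂'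
  have hM : (0 : ℝ) < 1 + 4 * Real.pi ^ 2 := by positivity
  have hH : (0 : ℝ) < 1 / 2 + Real.pi ^ 2 := by positivity
  set K := gaussianIntegral d (1 / 2 + Real.pi ^ 2) with hK
  set m : Ed d × Ed d × Ed d → ℂ := fun X =>
    σ X * (gaussian d (1 + 4 * Real.pi ^ 2) (X.1 - x) * e2pi ⟪X.1, X.2.1 + X.2.2 - ω⟫ *
      (FT d f₁ X.2.1 * FT d f₂ X.2.2)) with hm
  have hmi : Integrable m := by
    refine integrable_of_enorm_le_mul (G := fun X => gaussian d (1 + 4 * Real.pi ^ 2) (X.1 - x) *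
      (FT d f₁ X.2.1 * FT d f₂ X.2.2)) hB (by rw [hm]; fun_prop) ?_ fun X => ?_
    · exact (((integrable_gaussian hM).comp_sub_right x).mul_prod (hf₁.mul_prod hf₂)).2.ne
    · simp only [hm, enorm_mul, enorm_e2pi, mul_one]
      gcongr
      exact hσB X
  have hS : STFT d (gaussian d (1 + 4 * Real.pi ^ 2)) (biOp d σ f₁ f₂) x ω = ∫ X, m X := by
    rw [Measure.volume_eq_prod, integral_prod _ hmi, STFT]
    congr 1 with y
    rw [biOp, mul_assoc, ← integral_mul_const]
    congr 1 with ξ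
    simp only [hm]
    rw [inner_sub_right, sub_eq_add_neg ⟪y, ξ.1 + ξ.2⟫, e2pi_add]
    ring
  have key := enorm_integral_mul_integral_le (ν := (volume : Measure (Ed d × Ed d)))
    (hmi.const_mul (gaussianIntegral d 1 ^ 2))
    (w := fun X ξ => gaussian d (1 / 2 + Real.pi ^ 2) (X.2.1 - ξ.1) *
      gaussian d (1 / 2 + Real.pi ^ 2) (X.2.2 - ξ.2))
    (by fun_prop)
    (ENNReal.mul_ne_top (lintegral_gaussian_ne_top (d := d) hH)
      (lintegral_gaussian_ne_top (d := d) hH))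
    (fun X => by
      simp_rw [enorm_mul]
      rw [lintegral_prod_mul_enorm (f := fun ξ => gaussian d (1 / 2 + Real.pi ^ 2) (X.2.1 - ξ))
        (g := fun ξ => gaussian d (1 / 2 + Real.pi ^ 2) (X.2.2 - ξ)) (by fun_prop) (by fun_prop),
        lintegral_gaussian_sub_left, lintegral_gaussian_sub_left])
  refine le_of_eq_of_le ?_ (key.trans_eq ?_)
  · rw [← enorm_mul, hS, ← integral_const_mul]
    congr 2 with X
    have hp := integral_prod_mul (μ := (volume : Measure (Ed d))) (ν := (volume : Measure (Ed d)))
      (fun ξ => gaussian d (1 / 2 + Real.pi ^ 2) (X.2.1 - ξ))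
      (fun ξ => gaussian d (1 / 2 + Real.pi ^ 2) (X.2.2 - ξ))
    rw [integral_sub_left_eq_self (gaussian d (1 / 2 + Real.pi ^ 2)),
      integral_sub_left_eq_self (gaussian d (1 / 2 + Real.pi ^ 2)), ← gaussianIntegral, ← hK] at hp
    rw [Measure.volume_eq_prod, hp]
    ring
  · refine lintegral_congr fun ξ => ?_
    congr 2 with X
    simp only [hm, ← gaussian_mul]
    ring

/-- The constant appearing in the pointwise bound for the short-time Fourier transform of the
bilinear operator. -/
def decompositionConst (d : ℕ) : ℂ :=
  gaussianIntegral d 1 ^ 2 * gaussianIntegral d (1 / 2 + Real.pi ^ 2) ^ 2 * gaussianIntegral d 2 ^ 2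

theorem decompositionConst_ne_zero (d : ℕ) : decompositionConst d ≠ 0 :=
  mul_ne_zero (mul_ne_zero (pow_ne_zero 2 (gaussianIntegral_ne_zero one_pos))
    (pow_ne_zero 2 (gaussianIntegral_ne_zero (by positivity))))
    (pow_ne_zero 2 (gaussianIntegral_ne_zero two_pos))

theorem enorm_STFT_biOp_le_lintegral {σ : Ed d × Ed d × Ed d → ℂ} (hσ : Measurable σ)
    {B : ℝ≥0∞} (hB : B ≠ ∞) (hσB : ∀ X, ‖σ X‖ₑ ≤ B) {f₁ f₂ : Ed d → ℂ}
    (hf₁ : Integrable f₁) (hF₁ : Integrable (FT d f₁)) (hf₁' : Measurable f₁)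
    (hf₂ : Integrable f₂) (hF₂ : Integrable (FT d f₂)) (hf₂' : Measurable f₂) (x ω : Ed d) :
    ‖decompositionConst d‖ₑ *
      ‖STFT d (gaussian d (1 + 4 * Real.pi ^ 2)) (biOp d σ f₁ f₂) x ω‖ₑ ≤
    ∫⁻ ξ : Ed d × Ed d, ∫⁻ t : Ed d × Ed d,
      ‖STFT d (gauss d) f₁ t.1 ξ.1‖ₑ * ‖STFT d (gauss d) f₂ t.2 ξ.2‖ₑ *
      ∫⁻ a : Ed d × Ed d, ‖gaussian d 1 a.1‖ₑ * ‖gaussian d 1 a.2‖ₑ *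
        ‖symbSTFT d (gauss3 d) σ x (x - t.1) (x - t.2) (ξ.1 + a.1) (ξ.2 + a.2)
          (ω - ξ.1 - ξ.2 - (2 : ℝ) • (a.1 + a.2))‖ₑ := by
  rw [decompositionConst, enorm_mul, mul_comm ‖_ * _‖ₑ, mul_assoc]
  calc _ ≤ ‖gaussianIntegral d 2 ^ 2‖ₑ * _ := by
        gcongr
        exact enorm_STFT_biOp_le hσ hB hσB hF₁ hf₁' hF₂ hf₂' x ω
    _ = ∫⁻ ξ : Ed d × Ed d, ‖gaussianIntegral d 2 ^ 2‖ₑ * _ :=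
        (lintegral_const_mul' _ _ enorm_ne_top).symm
    _ ≤ _ := by
        refine lintegral_mono fun ξ => ?_
        refine (mul_le_mul_right (enorm_integral_le_lintegral_STFT
          (integrable_symbol_mul_gaussian hσ hB hσB (by positivity) (by positivity) x ω ξ.1 ξ.2)
          hf₁ hf₁' hf₂ hf₂' ξ.1 ξ.2) _).trans ?_
        rw [← lintegral_const_mul' _ _ enorm_ne_top]
        refine lintegral_mono fun t => ?_
        rw [mul_left_comm]
        gcongr
        exact enorm_integral_le_lintegral_symbSTFT hσ hB hσB x ω t.1 t.2 ξ.1 ξ.2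

theorem measurable_symbSTFT {Φ σ : Ed d × Ed d × Ed d → ℂ} (hΦ : Measurable Φ)
    (hσ : Measurable σ) :
    Measurable fun q : Ed d × Ed d × Ed d × Ed d × Ed d × Ed d =>
      symbSTFT d Φ σ q.1 q.2.1 q.2.2.1 q.2.2.2.1 q.2.2.2.2.1 q.2.2.2.2.2 := by
  have : Measurable (Function.uncurry fun (q : Ed d × Ed d × Ed d × Ed d × Ed d × Ed d)
      (X : Ed d × Ed d × Ed d) =>
      σ X * Φ (X.1 - q.1, X.2.1 - q.2.2.2.1, X.2.2 - q.2.2.2.2.1) *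
      e2pi (-(⟪X.1, q.2.2.2.2.2⟫ - ⟪q.2.1, X.2.1⟫ - ⟪q.2.2.1, X.2.2⟫))) := by fun_prop
  exact this.stronglyMeasurable.integral_prod_right.measurable

theorem measurable_biOp {σ : Ed d × Ed d × Ed d → ℂ} (hσ : Measurable σ) {f₁ f₂ : Ed d → ℂ}
    (hf₁ : Measurable f₁) (hf₂ : Measurable f₂) : Measurable (biOp d σ f₁ f₂) := by
  have h₁ := measurable_FT hf₁
  have h₂ := measurable_FT hf₂
  have : Measurable (Function.uncurry fun (x : Ed d) (ξ : Ed d × Ed d) =>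
      e2pi ⟪x, ξ.1 + ξ.2⟫ * σ (x, ξ.1, ξ.2) * FT d f₁ ξ.1 * FT d f₂ ξ.2) := by fun_prop
  exact this.stronglyMeasurable.integral_prod_right.measurable

theorem enorm_biOp_le {σ : Ed d × Ed d × Ed d → ℂ} {B : ℝ≥0∞} (hB : B ≠ ∞)
    (hσB : ∀ X, ‖σ X‖ₑ ≤ B) {f₁ f₂ : Ed d → ℂ} (hf₁ : Measurable f₁) (hf₂ : Measurable f₂)
    (x : Ed d) :
    ‖biOp d σ f₁ f₂ x‖ₑ ≤ B * ((∫⁻ ξ, ‖FT d f₁ ξ‖ₑ) * ∫⁻ ξ, ‖FT d f₂ ξ‖ₑ) := by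
  rw [← lintegral_prod_mul_enorm (measurable_FT hf₁) (measurable_FT hf₂),
    ← lintegral_const_mul' _ _ hB]
  refine (enorm_integral_le_lintegral_enorm _).trans (lintegral_mono fun ξ => ?_)
  rw [enorm_mul, enorm_mul, enorm_mul, enorm_e2pi, one_mul, mul_assoc]
  gcongr
  exact hσB _

end Decomposition

section Assembly

variable {d : ℕ}

theorem exists_exponent {r₀ r₁ r₂ r₀' r₁' r₂' p₁ p₂ p p' : ℝ≥0∞} (h₀ : r₀⁻¹ + r₀'⁻¹ = 1)
    (h₁ : r₁⁻¹ + r₁'⁻¹ = 1) (h₂ : r₂⁻¹ + r₂'⁻¹ = 1) (hp : p⁻¹ + p'⁻¹ = 1) (c₁ : r₀' ≤ p₁)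
    (c₂ : p₁ ≤ r₁') (c₃ : r₁' ≤ p₂) (c₄ : p₂ ≤ r₂')
    (hsum : 2 + p⁻¹ ≤ r₀⁻¹ + p₁⁻¹ + r₁⁻¹ + p₂⁻¹ + r₂⁻¹) :
    ∃ b : ℝ≥0∞, 1 ≤ b ∧ r₀'⁻¹ + r₁'⁻¹ + r₂'⁻¹ = p₁⁻¹ + p₂⁻¹ + b⁻¹ ∧ b⁻¹ ≤ p'⁻¹ := by
  rw [← ENNReal.inv_le_inv] at c₁ c₂ c₃ c₄
  have lift : ∀ {x : ℝ≥0∞}, x ≤ 1 → ∃ y : ℝ≥0, x = y := fun hx =>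
    ⟨_, (ENNReal.coe_toNNReal (ne_top_of_le_ne_top ENNReal.one_ne_top hx)).symm⟩
  obtain ⟨a₀, ha₀⟩ := lift (le_self_add.trans h₀.le)
  obtain ⟨a₁, ha₁⟩ := lift (le_self_add.trans h₁.le)
  obtain ⟨a₂, ha₂⟩ := lift (le_self_add.trans h₂.le)
  obtain ⟨b₀, hb₀⟩ := lift (le_add_self.trans h₀.le)
  obtain ⟨b₁, hb₁⟩ := lift (le_add_self.trans h₁.le)
  obtain ⟨b₂, hb₂⟩ := lift (le_add_self.trans h₂.le)
  obtain ⟨y₁, hy₁⟩ := lift (c₁.trans (le_add_self.trans h₀.le))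
  obtain ⟨y₂, hy₂⟩ := lift (c₃.trans (le_add_self.trans h₁.le))
  obtain ⟨x, hx⟩ := lift (le_self_add.trans hp.le)
  obtain ⟨x', hx'⟩ := lift (le_add_self.trans hp.le)
  rw [ha₀, hb₀] at h₀
  rw [ha₁, hb₁] at h₁
  rw [ha₂, hb₂] at h₂
  rw [hx, hx'] at hp
  rw [hx, ha₀, ha₁, ha₂, hy₁, hy₂] at hsum
  rw [hb₀, hy₁] at c₁
  rw [hb₁, hy₁] at c₂
  rw [hb₁, hy₂] at c₃
  rw [hb₂, hy₂] at c₄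
  rw [hb₀, hb₁, hb₂, hy₁, hy₂, hx']
  norm_cast at *
  rw [← NNReal.coe_inj] at h₀ h₁ h₂ hp
  rw [← NNReal.coe_le_coe] at hsum c₁ c₂ c₃ c₄
  push_cast at *
  obtain ⟨B, hB⟩ : ∃ B : ℝ≥0, (B : ℝ) = b₀ - y₁ + (b₁ - y₂) + b₂ :=
    ⟨⟨_, by linarith [b₂.coe_nonneg]⟩, rfl⟩
  refine ⟨(B : ℝ≥0∞)⁻¹, ?_, ?_, ?_⟩
  · rw [ENNReal.one_le_inv, ENNReal.coe_le_one_iff, ← NNReal.coe_le_coe, hB, NNReal.coe_one]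
    linarith [a₀.coe_nonneg]
  · rw [inv_inv]
    norm_cast
    rw [← NNReal.coe_inj]
    push_cast
    rw [hB]
    ring
  · rw [inv_inv, ENNReal.coe_le_coe, ← NNReal.coe_le_coe, hB]
    linarith

theorem exists_conjugate {p : ℝ≥0∞} (hp : 1 ≤ p) : ∃ p' : ℝ≥0∞, 1 ≤ p' ∧ p⁻¹ + p'⁻¹ = 1 :=
  ⟨(1 - p⁻¹)⁻¹, by simp, by rw [inv_inv]; exact add_tsub_cancel_of_le (ENNReal.inv_le_one.2 hp)⟩

theorem eNorm_enorm_gaussian_ne_top {M : ℝ} (hM : 0 < M) {a : ℝ≥0∞} (ha : 1 ≤ a) :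
    eNorm volume a (fun z => ‖gaussian d M z‖ₑ) ≠ ∞ := by
  by_cases ha' : a = ∞
  · subst ha'
    rw [eNorm_top]
    exact ne_top_of_le_ne_top ENNReal.one_ne_top
      (essSup_le_of_ae_le _ (Filter.Eventually.of_forall fun z => enorm_gaussian_le hM z))
  · rw [eNorm_of_ne_top ha']
    refine ENNReal.rpow_ne_top_of_nonneg (by positivity)
      (ne_top_of_le_ne_top (lintegral_gaussian_ne_top (d := d) hM) (lintegral_mono fun z => ?_))
    have h1 : 1 ≤ a.toReal := by
      simpa using (ENNReal.toReal_le_toReal ENNReal.one_ne_top ha').2 ha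
    calc ‖gaussian d M z‖ₑ ^ a.toReal ≤ ‖gaussian d M z‖ₑ ^ (1 : ℝ) :=
          ENNReal.rpow_le_rpow_of_exponent_ge (enorm_gaussian_le hM z) h1
      _ = _ := ENNReal.rpow_one _

theorem exists_eNorm_le_of_le_convolution {M : ℝ} (hM : 0 < M) {p p' b : ℝ≥0∞}
    (h : p⁻¹ + p'⁻¹ = 1) (hp' : 1 ≤ p') (hb : 1 ≤ b) (hbp : b⁻¹ ≤ p'⁻¹) :
    ∃ C : ℝ≥0∞, C ≠ ∞ ∧ ∀ (A B : Ed d → ℝ≥0∞) (Y : ℝ≥0∞), Measurable A → Measurable B →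
      (∀ x, A x ≤ ∫⁻ y, ‖gaussian d M (y - x)‖ₑ * B y) →
      (∀ k, Measurable k → ∫⁻ y, k y * B y ≤ Y * eNorm volume b k) →
      eNorm volume p A ≤ C * Y := by
  have hp1 : p'⁻¹ ≤ 1 := ENNReal.inv_le_one.2 hp'
  have hpt : p'⁻¹ ≠ ∞ := ne_top_of_le_ne_top ENNReal.one_ne_top hp1
  set a : ℝ≥0∞ := (1 - p'⁻¹ + b⁻¹)⁻¹ with ha
  have hsum : a⁻¹ + p'⁻¹ = 1 + b⁻¹ := by
    rw [ha, inv_inv, add_right_comm, tsub_add_cancel_of_le hp1]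
  have ha1 : a⁻¹ ≤ 1 := by
    rw [ha, inv_inv]
    calc 1 - p'⁻¹ + b⁻¹ ≤ 1 - p'⁻¹ + p'⁻¹ := by gcongr
      _ = 1 := tsub_add_cancel_of_le hp1
  have hba : b⁻¹ ≤ a⁻¹ := by rw [ha, inv_inv]; exact le_add_self
  have ha' : 1 ≤ a := ENNReal.inv_le_one.1 ha1
  refine ⟨eNorm volume a fun z => ‖gaussian d M z‖ₑ, eNorm_enorm_gaussian_ne_top hM ha',
    fun A B Y hA hB hAB hY => ?_⟩
  refine eNorm_le_of_forall_lintegral_mul_le h hA fun k hk => ?_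
  have young := eNorm_eNorm_sub_mul_le (u := 1) (v := b) (p := a) (a := p') le_rfl ha' hb hp'
    (by simpa using hsum.symm) hba (by simpa using ha1)
    (g := fun z : Ed d => ‖gaussian d M z‖ₑ) (by fun_prop) hk
  simp_rw [eNorm_one] at young
  calc ∫⁻ x, k x * A x
      ≤ ∫⁻ x, k x * ∫⁻ y, ‖gaussian d M (y - x)‖ₑ * B y := by
        gcongr with x
        exact hAB x
    _ = ∫⁻ x, ∫⁻ y, k x * (‖gaussian d M (y - x)‖ₑ * B y) := by
        congr 1 with x
        rw [lintegral_const_mul _ (by fun_prop)]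
    _ = ∫⁻ y, ∫⁻ x, k x * (‖gaussian d M (y - x)‖ₑ * B y) :=
        lintegral_lintegral_swap (by fun_prop)
    _ = ∫⁻ y, (∫⁻ x, ‖gaussian d M (x - y)‖ₑ * k x) * B y := by
        congr 1 with y
        rw [← lintegral_mul_const _ (by fun_prop)]
        congr 1 with x
        rw [gaussian_sub_comm]
        ring
    _ ≤ Y * eNorm volume b fun y => ∫⁻ x, ‖gaussian d M (x - y)‖ₑ * k x := by
        refine hY _ (Measurable.lintegral_prod_right' (f := fun q : Ed d × Ed d =>
          ‖gaussian d M (q.2 - q.1)‖ₑ * k q.2) (by fun_prop))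
    _ ≤ Y * (eNorm volume a (fun z => ‖gaussian d M z‖ₑ) * eNorm volume p' k) := by gcongr
    _ = _ := by ring

theorem exists_modNorm_le {p p' b q q' b' : ℝ≥0∞} (hp : p⁻¹ + p'⁻¹ = 1) (hp' : 1 ≤ p')
    (hb : 1 ≤ b) (hbp : b⁻¹ ≤ p'⁻¹) (hq : q⁻¹ + q'⁻¹ = 1) (hq' : 1 ≤ q') (hb' : 1 ≤ b')
    (hbq : b'⁻¹ ≤ q'⁻¹) :
    ∃ C : ℝ≥0∞, C ≠ ∞ ∧ ∀ (T : Ed d → ℂ) (B Z : ℝ≥0∞) (Y : Ed d → ℝ≥0∞), Measurable T → B ≠ ∞ →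
      (∀ y, ‖T y‖ₑ ≤ B) → Measurable Y →
      (∀ η k, Measurable k →
        ∫⁻ x, k x * ‖STFT d (gaussian d (1 + 4 * Real.pi ^ 2)) T x η‖ₑ ≤
          Y η * eNorm volume b k) →
      (∀ k, Measurable k → ∫⁻ η, k η * Y η ≤ Z * eNorm volume b' k) →
      modNorm d p q T ≤ C * Z := by
  set N : ℝ := 1 + 4 * Real.pi ^ 2 with hN
  have hN0 : 0 < N := by positivity
  set N' : ℝ := N + Real.pi ^ 2 with hN'
  have hN'1 : 0 < N' - 1 := by rw [hN', hN]; ring_nf; positivity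
  have hN'0 : 0 < N' := by linarith
  set M : ℝ := N' / (N' - 1) with hM
  have hM0 : 0 < M := by positivity
  have hMN : M * N' / (M + N') = 1 := by
    rw [hM]
    field_simp
    ring
  obtain ⟨C₁, hC₁, H₁⟩ := exists_eNorm_le_of_le_convolution (d := d) hM0 hp hp' hb hbp
  obtain ⟨C₂, hC₂, H₂⟩ := exists_eNorm_le_of_le_convolution (d := d) one_pos hq hq' hb' hbq
  set c₁ : ℝ≥0∞ := ‖gaussianIntegral d (M + N')‖ₑ with hc₁
  set c₂ : ℝ≥0∞ := ‖gaussianIntegral d 1‖ₑ with hc₂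
  have hc₁0 : c₁ ≠ 0 := by simpa [hc₁] using gaussianIntegral_ne_zero (by positivity)
  have hc₂0 : c₂ ≠ 0 := by simpa [hc₂] using gaussianIntegral_ne_zero (d := d) one_pos
  have hc₁t : c₁ ≠ ∞ := enorm_ne_top
  have hc₂t : c₂ ≠ ∞ := enorm_ne_top
  refine ⟨C₂ * (c₁⁻¹ * (C₁ * c₂⁻¹)), ?_, fun T B Z Y hT hB hTB hY hYb hZ => ?_⟩
  · have := ENNReal.inv_ne_top.2 hc₁0
    have := ENNReal.inv_ne_top.2 hc₂0
    finiteness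
  have le_inv : ∀ {c u v : ℝ≥0∞}, c ≠ 0 → c ≠ ∞ → c * u ≤ v → u ≤ c⁻¹ * v := by
    intro c u v h0 ht h
    calc u = c⁻¹ * (c * u) := by rw [← mul_assoc, ENNReal.inv_mul_cancel h0 ht, one_mul]
      _ ≤ _ := by gcongr
  obtain ⟨D, hD⟩ : ∃ D : Ed d → Ed d → ℝ≥0∞, D = fun x η => ‖STFT d (gaussian d N) T x η‖ₑ :=
    ⟨_, rfl⟩
  obtain ⟨E, hE⟩ : ∃ E : Ed d → Ed d → ℝ≥0∞, E = fun x η => ‖STFT d (gaussian d N') T x η‖ₑ :=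
    ⟨_, rfl⟩
  obtain ⟨A, hA⟩ : ∃ A : Ed d → Ed d → ℝ≥0∞, A = fun x η => ‖STFT d (gauss d) T x η‖ₑ :=
    ⟨_, rfl⟩
  have mD : Measurable (Function.uncurry D) := by
    rw [hD]; exact (measurable_STFT (measurable_gaussian N) hT).enorm
  have mE : Measurable (Function.uncurry E) := by
    rw [hE]; exact (measurable_STFT (measurable_gaussian N') hT).enorm
  have mA : Measurable (Function.uncurry A) := by
    rw [hA, gauss_eq_gaussian]; exact (measurable_STFT (measurable_gaussian 1) hT).enorm
  have hAE : ∀ x η, A x η ≤ c₁⁻¹ * ∫⁻ y, ‖gaussian d M (y - x)‖ₑ * E y η := by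
    intro x η
    refine le_inv hc₁0 hc₁t ?_
    have := enorm_STFT_le_lintegral_time hT hB hTB hM0 hN'0 x η
    rw [hMN, ← gauss_eq_gaussian] at this
    rw [hA, hE]
    refine this.trans_eq ?_
    rw [← lintegral_sub_right_eq_self _ x]
    simp
  have hED : ∀ x η, E x η ≤ c₂⁻¹ * ∫⁻ ω, ‖gaussian d 1 (ω - η)‖ₑ * D x ω := by
    intro x η
    refine le_inv hc₂0 hc₂t ?_
    have := enorm_STFT_le_lintegral_freq hT hB hTB hN0 x η
    rw [hE, hD]
    refine this.trans_eq ?_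
    rw [← lintegral_sub_left_eq_self _ η]
    simp_rw [gaussian_sub_comm 1 η, sub_sub_cancel]
  have mY' : Measurable fun η => ∫⁻ ω, ‖gaussian d 1 (ω - η)‖ₑ * Y ω :=
    Measurable.lintegral_prod_right' (f := fun q : Ed d × Ed d =>
      ‖gaussian d 1 (q.2 - q.1)‖ₑ * Y q.2) (by fun_prop)
  have hinner : ∀ η, eNorm volume p (fun x => A x η) ≤
      c₁⁻¹ * (C₁ * c₂⁻¹) * ∫⁻ ω, ‖gaussian d 1 (ω - η)‖ₑ * Y ω := by
    intro η
    have := H₁ (fun x => A x η) (fun y => c₁⁻¹ * E y η)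
      (c₁⁻¹ * (c₂⁻¹ * ∫⁻ ω, ‖gaussian d 1 (ω - η)‖ₑ * Y ω)) mA.of_uncurry_right
      (mE.of_uncurry_right.const_mul _) (fun x => ?_) fun k hk => ?_
    · exact this.trans_eq (by ring)
    · refine (hAE x η).trans_eq ?_
      have := mE.of_uncurry_right (y := η)
      rw [← lintegral_const_mul _ (by fun_prop)]
      congr 1 with y
      ring
    · calc ∫⁻ y, k y * (c₁⁻¹ * E y η)
          ≤ ∫⁻ y, k y * (c₁⁻¹ * (c₂⁻¹ * ∫⁻ ω, ‖gaussian d 1 (ω - η)‖ₑ * D y ω)) := by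
            gcongr with y
            exact hED y η
        _ = ∫⁻ y, ∫⁻ ω, c₁⁻¹ * c₂⁻¹ * ‖gaussian d 1 (ω - η)‖ₑ * (k y * D y ω) := by
            congr 1 with y
            have := mD.of_uncurry_left (x := y)
            rw [← mul_assoc, ← mul_assoc, ← lintegral_const_mul _ (by fun_prop)]
            congr 1 with ω
            ring
        _ = ∫⁻ ω, ∫⁻ y, c₁⁻¹ * c₂⁻¹ * ‖gaussian d 1 (ω - η)‖ₑ * (k y * D y ω) := by
            refine lintegral_lintegral_swap ?_
            have : Measurable fun q : Ed d × Ed d => D q.1 q.2 := mD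
            exact Measurable.aemeasurable (by unfold Function.uncurry; fun_prop)
        _ ≤ ∫⁻ ω, c₁⁻¹ * c₂⁻¹ * ‖gaussian d 1 (ω - η)‖ₑ * (Y ω * eNorm volume b k) := by
            gcongr with ω
            have := mD.of_uncurry_right (y := ω)
            rw [lintegral_const_mul _ (by fun_prop)]
            gcongr
            have := hYb ω k hk
            rwa [hD]
        _ = _ := by
            rw [← mul_assoc, ← lintegral_const_mul _ (by fun_prop),
              ← lintegral_mul_const _ (by fun_prop)]
            congr 1 with ω
            ring
  have := H₂ (fun η => eNorm volume p fun x => A x η)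
    (fun ω => c₁⁻¹ * (C₁ * c₂⁻¹) * Y ω) (c₁⁻¹ * (C₁ * c₂⁻¹) * Z)
    (measurable_eNorm p (F := fun η x => A x η) (mA.comp measurable_swap))
    (by fun_prop) (fun η => ?_) fun k hk => ?_
  · rw [mul_assoc]
    refine le_trans (le_of_eq ?_) this
    rw [hA]
    rfl
  · refine (hinner η).trans_eq ?_
    rw [← lintegral_const_mul _ (by fun_prop)]
    congr 1 with ω
    ring
  · rw [mul_assoc]
    refine le_trans (le_of_eq ?_) (mul_le_mul_right (hZ k hk) _)
    rw [← lintegral_const_mul _ (by fun_prop)]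
    congr 1 with ω
    ring

end Assembly

section Boundedness

variable {d : ℕ}

theorem lintegral_mul_lintegral_prod_time_le {r₀ r₁ r₂ r₀' r₁' r₂' p₁ p₂ b : ℝ≥0∞}
    (h₀ : r₀⁻¹ + r₀'⁻¹ = 1) (h₁ : r₁⁻¹ + r₁'⁻¹ = 1) (h₂ : r₂⁻¹ + r₂'⁻¹ = 1) (hr : 1 ≤ r₀')
    (c₁ : r₀' ≤ p₁) (c₂ : p₁ ≤ r₁') (c₃ : r₁' ≤ p₂) (c₄ : p₂ ≤ r₂') (hb : 1 ≤ b)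
    (hsum : r₀'⁻¹ + r₁'⁻¹ + r₂'⁻¹ = p₁⁻¹ + p₂⁻¹ + b⁻¹)
    {F : Ed d × Ed d × Ed d → ℝ≥0∞} {g₁ g₂ k : Ed d → ℝ≥0∞} (hF : Measurable F)
    (hg₁ : Measurable g₁) (hg₂ : Measurable g₂) (hk : Measurable k) :
    ∫⁻ x, k x * ∫⁻ t : Ed d × Ed d, g₁ t.1 * g₂ t.2 * F (x, x - t.1, x - t.2) ≤
      eNorm volume r₂ (fun t₂ => eNorm volume r₁ fun t₁ => eNorm volume r₀ fun x => F (x, t₁, t₂)) *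
        (eNorm volume p₁ g₁ * (eNorm volume p₂ g₂ * eNorm volume b k)) := by
  refine le_trans (le_of_eq ?_) (lintegral_time_le h₀ h₁ h₂ hr c₁ c₂ c₃ c₄ hb hsum
    (F := fun x t₁ t₂ => F (x, t₁, t₂)) hF hg₁ hg₂ hk)
  calc ∫⁻ x, k x * ∫⁻ t : Ed d × Ed d, g₁ t.1 * g₂ t.2 * F (x, x - t.1, x - t.2)
      = ∫⁻ x, ∫⁻ t : Ed d × Ed d,
          F (x, t.1, t.2) * (g₁ (x - t.1) * (g₂ (x - t.2) * k x)) := by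
        congr 1 with x
        have hx : MeasurePreserving (Prod.map (fun t => x - t) fun t => x - t)
            (volume : Measure (Ed d × Ed d)) volume :=
          (Measure.measurePreserving_sub_left volume x).prod
            (Measure.measurePreserving_sub_left volume x)
        rw [← lintegral_const_mul _ (by fun_prop), ← hx.lintegral_comp (by fun_prop)]
        refine lintegral_congr fun t => ?_
        simp only [Prod.map_fst, Prod.map_snd, sub_sub_cancel]
        ring
    _ = ∫⁻ t : Ed d × Ed d, ∫⁻ x,
          F (x, t.1, t.2) * (g₁ (x - t.1) * (g₂ (x - t.2) * k x)) :=
        lintegral_lintegral_swap (by fun_prop)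
    _ = _ := lintegral_prod_symm' _ (Measurable.lintegral_prod_right'
        (f := fun q : (Ed d × Ed d) × Ed d => F (q.2, q.1.1, q.1.2) *
          (g₁ (q.2 - q.1.1) * (g₂ (q.2 - q.1.2) * k q.2))) (by fun_prop))

theorem lintegral_mul_lintegral_prod_freq_le {s₁ s₂ s₃ s₁' s₂' s₃' q₁ q₂ b : ℝ≥0∞}
    (h₁ : s₁⁻¹ + s₁'⁻¹ = 1) (h₂ : s₂⁻¹ + s₂'⁻¹ = 1) (h₃ : s₃⁻¹ + s₃'⁻¹ = 1) (hs : 1 ≤ s₁')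
    (c₁ : s₁' ≤ q₁) (c₂ : q₁ ≤ s₂') (c₃ : s₂' ≤ q₂) (c₄ : q₂ ≤ s₃') (hb : 1 ≤ b)
    (hsum : s₁'⁻¹ + s₂'⁻¹ + s₃'⁻¹ = q₁⁻¹ + q₂⁻¹ + b⁻¹)
    {N : Ed d × Ed d × Ed d → ℝ≥0∞} {g₁ g₂ k : Ed d → ℝ≥0∞} (hN : Measurable N)
    (hg₁ : Measurable g₁) (hg₂ : Measurable g₂) (hk : Measurable k) (a₁ a₂ v : Ed d) :
    ∫⁻ η, k η * ∫⁻ ξ : Ed d × Ed d, g₁ ξ.1 * g₂ ξ.2 *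
        N (ξ.1 + a₁, ξ.2 + a₂, η - ξ.1 - ξ.2 - v) ≤
      eNorm volume s₃ (fun ν => eNorm volume s₂ fun ξ₂ => eNorm volume s₁ fun ξ₁ => N (ξ₁, ξ₂, ν)) *
        (eNorm volume q₁ g₁ * (eNorm volume q₂ g₂ * eNorm volume b k)) := by
  obtain ⟨N₁, hN₁⟩ : ∃ N₁ : Ed d → Ed d → ℝ≥0∞, N₁ = fun ν ξ₂ =>
    eNorm volume s₁ fun ξ₁ => N (ξ₁, ξ₂, ν) := ⟨_, rfl⟩
  have m₁ : Measurable (Function.uncurry N₁) := by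
    rw [hN₁]
    exact measurable_eNorm s₁ (F := fun (w : Ed d × Ed d) ξ₁ => N (ξ₁, w.2, w.1))
      (by unfold Function.uncurry; fun_prop)
  obtain ⟨N₂, hN₂⟩ : ∃ N₂ : Ed d → ℝ≥0∞, N₂ = fun ν => eNorm volume s₂ (N₁ ν) := ⟨_, rfl⟩
  have m₂ : Measurable N₂ := by
    rw [hN₂]
    exact measurable_eNorm s₂ m₁
  have e₁ : ∀ ξ₂ ν, eNorm volume s₁ (fun ξ₁ => N (ξ₁ + a₁, ξ₂, ν)) = N₁ ν ξ₂ := fun ξ₂ ν => by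
    rw [hN₁]
    exact eNorm_comp_add_right s₁ (F := fun ξ₁ => N (ξ₁, ξ₂, ν)) (by fun_prop) a₁
  have e₂ : ∀ ν, eNorm volume s₂ (fun ξ₂ => N₁ ν (ξ₂ + a₂)) = N₂ ν := fun ν => by
    rw [hN₂]
    exact eNorm_comp_add_right s₂ (F := N₁ ν) m₁.of_uncurry_left a₂
  have e₃ : eNorm volume s₃ (fun ν => eNorm volume s₂ fun ξ₂ => eNorm volume s₁ fun ξ₁ =>
        N (ξ₁ + a₁, ξ₂ + a₂, ν - v)) =
      eNorm volume s₃ (fun ν => eNorm volume s₂ fun ξ₂ => eNorm volume s₁ fun ξ₁ =>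
        N (ξ₁, ξ₂, ν)) := by
    simp_rw [e₁, e₂]
    rw [eNorm_comp_sub_right s₃ m₂ v, hN₂, hN₁]
  rw [← e₃]
  refine le_trans (le_of_eq ?_) (lintegral_freq_le h₁ h₂ h₃ hs c₁ c₂ c₃ c₄ hb hsum
    (G := fun ξ₁ ξ₂ ν => N (ξ₁ + a₁, ξ₂ + a₂, ν - v)) (by fun_prop) hg₁ hg₂ hk)
  refine lintegral_congr fun η => ?_
  congr 1
  rw [Measure.volume_eq_prod, lintegral_prod_symm' _ (by fun_prop)]
  simp_rw [mul_comm]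

theorem lintegral_mul_le_of_decomposition {r₀ r₁ r₂ r₀' r₁' r₂' p₁ p₂ b : ℝ≥0∞}
    (h₀ : r₀⁻¹ + r₀'⁻¹ = 1) (h₁ : r₁⁻¹ + r₁'⁻¹ = 1) (h₂ : r₂⁻¹ + r₂'⁻¹ = 1) (hr : 1 ≤ r₀')
    (c₁ : r₀' ≤ p₁) (c₂ : p₁ ≤ r₁') (c₃ : r₁' ≤ p₂) (c₄ : p₂ ≤ r₂') (hb : 1 ≤ b)
    (hsum : r₀'⁻¹ + r₁'⁻¹ + r₂'⁻¹ = p₁⁻¹ + p₂⁻¹ + b⁻¹)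
    {S : Ed d × Ed d × Ed d × Ed d × Ed d × Ed d → ℝ≥0∞} (hS : Measurable S)
    {V₁ V₂ : Ed d × Ed d → ℝ≥0∞} (hV₁ : Measurable V₁) (hV₂ : Measurable V₂)
    {G : Ed d × Ed d → ℝ≥0∞} (hG : Measurable G) {N : Ed d × Ed d × Ed d → ℝ≥0∞}
    (hN : N = fun w => eNorm volume r₂ fun t₂ => eNorm volume r₁ fun t₁ => eNorm volume r₀ fun x =>
      S (x, t₁, t₂, w.1, w.2.1, w.2.2)) (hN' : Measurable N)
    {B₁ B₂ : Ed d → ℝ≥0∞} (hB₁ : B₁ = fun ξ => eNorm volume p₁ fun t => V₁ (t, ξ))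
    (hB₁' : Measurable B₁) (hB₂ : B₂ = fun ξ => eNorm volume p₂ fun t => V₂ (t, ξ))
    (hB₂' : Measurable B₂) (η : Ed d) {D k : Ed d → ℝ≥0∞} (hk : Measurable k)
    (hD : ∀ x, D x ≤ ∫⁻ ξ : Ed d × Ed d, ∫⁻ t : Ed d × Ed d, V₁ (t.1, ξ.1) * V₂ (t.2, ξ.2) *
      ∫⁻ a : Ed d × Ed d, G a * S (x, x - t.1, x - t.2, ξ.1 + a.1, ξ.2 + a.2,
        η - ξ.1 - ξ.2 - (2 : ℝ) • (a.1 + a.2))) :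
    ∫⁻ x, k x * D x ≤ (∫⁻ a : Ed d × Ed d, G a * ∫⁻ ξ : Ed d × Ed d, B₁ ξ.1 * B₂ ξ.2 *
      N (ξ.1 + a.1, ξ.2 + a.2, η - ξ.1 - ξ.2 - (2 : ℝ) • (a.1 + a.2))) * eNorm volume b k := by
  obtain ⟨R, hR⟩ : ∃ R : (Ed d × Ed d) → (Ed d × Ed d) → Ed d → ℝ≥0∞, R = fun a ξ x =>
      ∫⁻ t : Ed d × Ed d, V₁ (t.1, ξ.1) * V₂ (t.2, ξ.2) * S (x, x - t.1, x - t.2, ξ.1 + a.1,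
        ξ.2 + a.2, η - ξ.1 - ξ.2 - (2 : ℝ) • (a.1 + a.2)) := ⟨_, rfl⟩
  have mR : Measurable fun q : (Ed d × Ed d) × (Ed d × Ed d) × Ed d => R q.1 q.2.1 q.2.2 := by
    rw [hR]
    exact Measurable.lintegral_prod_right'
      (f := fun q : ((Ed d × Ed d) × (Ed d × Ed d) × Ed d) × Ed d × Ed d =>
        V₁ (q.2.1, q.1.2.1.1) * V₂ (q.2.2, q.1.2.1.2) * S (q.1.2.2, q.1.2.2 - q.2.1,
          q.1.2.2 - q.2.2, q.1.2.1.1 + q.1.1.1, q.1.2.1.2 + q.1.1.2,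
          η - q.1.2.1.1 - q.1.2.1.2 - (2 : ℝ) • (q.1.1.1 + q.1.1.2))) (by fun_prop)
  have hDR : ∀ x, D x ≤ ∫⁻ ξ, ∫⁻ a, G a * R a ξ x := by
    intro x
    refine (hD x).trans_eq ?_
    congr 1 with ξ
    rw [hR]
    calc ∫⁻ t : Ed d × Ed d, V₁ (t.1, ξ.1) * V₂ (t.2, ξ.2) *
          ∫⁻ a : Ed d × Ed d, G a * S (x, x - t.1, x - t.2, ξ.1 + a.1, ξ.2 + a.2,
            η - ξ.1 - ξ.2 - (2 : ℝ) • (a.1 + a.2))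
        = ∫⁻ t : Ed d × Ed d, ∫⁻ a : Ed d × Ed d, G a * (V₁ (t.1, ξ.1) * V₂ (t.2, ξ.2) *
            S (x, x - t.1, x - t.2, ξ.1 + a.1, ξ.2 + a.2,
              η - ξ.1 - ξ.2 - (2 : ℝ) • (a.1 + a.2))) := by
          congr 1 with t
          rw [← lintegral_const_mul _ (by fun_prop)]
          congr 1 with a
          ring
      _ = ∫⁻ a : Ed d × Ed d, ∫⁻ t : Ed d × Ed d, G a * (V₁ (t.1, ξ.1) * V₂ (t.2, ξ.2) *
            S (x, x - t.1, x - t.2, ξ.1 + a.1, ξ.2 + a.2,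
              η - ξ.1 - ξ.2 - (2 : ℝ) • (a.1 + a.2))) :=
          lintegral_lintegral_swap (by fun_prop)
      _ = _ := by
          congr 1 with a
          rw [lintegral_const_mul _ (by fun_prop)]
  have hRN : ∀ a ξ, ∫⁻ x, k x * R a ξ x ≤ B₁ ξ.1 * B₂ ξ.2 *
      N (ξ.1 + a.1, ξ.2 + a.2, η - ξ.1 - ξ.2 - (2 : ℝ) • (a.1 + a.2)) * eNorm volume b k := by
    intro a ξ
    refine le_trans (le_of_eq ?_) ((lintegral_mul_lintegral_prod_time_le h₀ h₁ h₂ hr c₁ c₂ c₃ c₄ hb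
      hsum (F := fun X => S (X.1, X.2.1, X.2.2, ξ.1 + a.1, ξ.2 + a.2,
        η - ξ.1 - ξ.2 - (2 : ℝ) • (a.1 + a.2))) (g₁ := fun t => V₁ (t, ξ.1))
      (g₂ := fun t => V₂ (t, ξ.2)) (by fun_prop) (by fun_prop) (by fun_prop) hk).trans_eq ?_)
    · rw [hR]
    · rw [hB₁, hB₂, hN]
      ring
  calc ∫⁻ x, k x * D x ≤ ∫⁻ x, k x * ∫⁻ ξ, ∫⁻ a, G a * R a ξ x := by
        gcongr with x
        exact hDR x
    _ = ∫⁻ x, ∫⁻ q : (Ed d × Ed d) × (Ed d × Ed d), k x * (G q.2 * R q.2 q.1 x) := by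
        congr 1 with x
        rw [lintegral_const_mul _ (by fun_prop), Measure.volume_eq_prod (Ed d × Ed d),
          lintegral_prod _ (by fun_prop)]
    _ = ∫⁻ q : (Ed d × Ed d) × (Ed d × Ed d), ∫⁻ x, k x * (G q.2 * R q.2 q.1 x) :=
        lintegral_lintegral_swap (by fun_prop)
    _ ≤ ∫⁻ q : (Ed d × Ed d) × (Ed d × Ed d), G q.2 * (B₁ q.1.1 * B₂ q.1.2 *
          N (q.1.1 + q.2.1, q.1.2 + q.2.2, η - q.1.1 - q.1.2 - (2 : ℝ) • (q.2.1 + q.2.2)) *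
          eNorm volume b k) := by
        refine lintegral_mono fun q => ?_
        simp_rw [mul_left_comm _ (G q.2)]
        rw [lintegral_const_mul _ (by fun_prop)]
        gcongr
        exact hRN q.2 q.1
    _ = _ := by
        rw [Measure.volume_eq_prod (Ed d × Ed d), lintegral_prod_symm' _ (by fun_prop),
          ← lintegral_mul_const _ (by fun_prop)]
        congr 1 with a
        dsimp only
        rw [lintegral_const_mul _ (by fun_prop), lintegral_mul_const _ (by fun_prop), mul_assoc]

end Boundedness

/-- boundedness of bilinear pseudodifferential operators under the
monotone-chain conditions (Corollary `thm:increasing` of the paper for `m = 2`). -/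
theorem stmt9 (d : ℕ) (hd : 1 ≤ d)
    (p₀ p₁ p₂ q₁ q₂ q₃ r₀ r₁ r₂ s₁ s₂ s₃ r₀' r₁' r₂' s₁' s₂' s₃' : ℝ≥0∞)
    (hp₀ : 1 ≤ p₀) (hp₁ : 1 ≤ p₁) (hp₂ : 1 ≤ p₂)
    (hq₁ : 1 ≤ q₁) (hq₂ : 1 ≤ q₂) (hq₃ : 1 ≤ q₃)
    (hr₀ : 1 ≤ r₀) (hr₁ : 1 ≤ r₁) (hr₂ : 1 ≤ r₂)
    (hs₁ : 1 ≤ s₁) (hs₂ : 1 ≤ s₂) (hs₃ : 1 ≤ s₃)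
    (hc₀ : 1 / r₀ + 1 / r₀' = 1) (hc₁ : 1 / r₁ + 1 / r₁' = 1) (hc₂ : 1 / r₂ + 1 / r₂' = 1)
    (hd₁ : 1 / s₁ + 1 / s₁' = 1) (hd₂ : 1 / s₂ + 1 / s₂' = 1) (hd₃ : 1 / s₃ + 1 / s₃' = 1)
    (chain₁ : 1 ≤ r₀') (chain₂ : r₀' ≤ p₁) (chain₃ : p₁ ≤ r₁') (chain₄ : r₁' ≤ p₂)
    (chain₅ : p₂ ≤ r₂')
    (chain₆ : 1 ≤ s₁') (chain₇ : s₁' ≤ q₁) (chain₈ : q₁ ≤ s₂') (chain₉ : s₂' ≤ q₂)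
    (chain₁₀ : q₂ ≤ s₃')
    (hsum₁ : 2 + 1 / p₀ ≤ 1 / r₀ + 1 / p₁ + 1 / r₁ + 1 / p₂ + 1 / r₂)
    (hsum₂ : 2 + 1 / q₃ ≤ 1 / s₃ + 1 / q₁ + 1 / s₁ + 1 / q₂ + 1 / s₂) :
    ∃ C : ℝ≥0, 0 < C ∧
      ∀ σ : Ed d × Ed d × Ed d → ℂ, Measurable σ → (∃ M : ℝ, ∀ X, ‖σ X‖ ≤ M) →
        symbNorm d r₀ r₁ r₂ s₁ s₂ s₃ σ < ∞ →
        ∀ f₁ f₂ : SchwartzMap (Ed d) ℂ,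
          modNorm d p₀ q₃ (biOp d σ (⇑f₁) (⇑f₂)) ≤
            (C : ℝ≥0∞) * symbNorm d r₀ r₁ r₂ s₁ s₂ s₃ σ *
              modNorm d p₁ q₁ (⇑f₁) * modNorm d p₂ q₂ (⇑f₂) := by
  simp only [one_div] at hc₀ hc₁ hc₂ hd₁ hd₂ hd₃ hsum₁ hsum₂
  obtain ⟨p', hp', hp⟩ := exists_conjugate hp₀
  obtain ⟨q', hq', hq⟩ := exists_conjugate hq₃
  obtain ⟨b, hb, hbsum, hbp⟩ :=
    exists_exponent hc₀ hc₁ hc₂ hp chain₂ chain₃ chain₄ chain₅ hsum₁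
  obtain ⟨b', hb', hbsum', hbq⟩ :=
    exists_exponent hd₁ hd₂ hd₃ hq chain₇ chain₈ chain₉ chain₁₀ (hsum₂.trans_eq (by ring))
  obtain ⟨C, hC, H⟩ := exists_modNorm_le (d := d) hp hp' hb hbp hq hq' hb' hbq
  obtain ⟨G, hG⟩ : ∃ G : Ed d × Ed d → ℝ≥0∞,
    G = fun a => ‖gaussian d 1 a.1‖ₑ * ‖gaussian d 1 a.2‖ₑ := ⟨_, rfl⟩
  have mG : Measurable G := by rw [hG]; fun_prop
  have hGt : ∫⁻ a, G a ≠ ∞ := by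
    rw [hG, lintegral_prod_mul_enorm (measurable_gaussian 1) (measurable_gaussian 1)]
    exact ENNReal.mul_ne_top (lintegral_gaussian_ne_top one_pos)
      (lintegral_gaussian_ne_top one_pos)
  set c : ℝ≥0∞ := ‖decompositionConst d‖ₑ with hc
  have hc0 : c ≠ 0 := by simpa [hc] using decompositionConst_ne_zero d
  have hct : c ≠ ∞ := enorm_ne_top
  have hci : c⁻¹ ≠ ∞ := ENNReal.inv_ne_top.2 hc0
  refine ⟨(C * (c⁻¹ * ∫⁻ a, G a)).toNNReal + 1, by positivity, fun σ hσ hσM _ f₁ f₂ => ?_⟩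
  obtain ⟨M, hM⟩ := hσM
  have hσB : ∀ X, ‖σ X‖ₑ ≤ ENNReal.ofReal M := fun X => by
    rw [← ofReal_norm]
    exact ENNReal.ofReal_le_ofReal (hM X)
  have mf : ∀ f : SchwartzMap (Ed d) ℂ, Measurable f := fun f => f.continuous.measurable
  have iF : ∀ f : SchwartzMap (Ed d) ℂ, Integrable (FT d f) := fun f => by
    rw [FT_eq_fourier, ← SchwartzMap.fourier_coe]
    exact (FourierTransform.fourier f).integrable
  have mV : ∀ f : SchwartzMap (Ed d) ℂ,
      Measurable fun z : Ed d × Ed d => ‖STFT d (gauss d) f z.1 z.2‖ₑ := fun f => by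
    rw [gauss_eq_gaussian]
    exact (measurable_STFT (measurable_gaussian 1) (mf f)).enorm
  obtain ⟨S, hS⟩ : ∃ S : Ed d × Ed d × Ed d × Ed d × Ed d × Ed d → ℝ≥0∞, S = fun q =>
    ‖symbSTFT d (gauss3 d) σ q.1 q.2.1 q.2.2.1 q.2.2.2.1 q.2.2.2.2.1 q.2.2.2.2.2‖ₑ := ⟨_, rfl⟩
  have mS : Measurable S := by
    rw [hS]
    exact (measurable_symbSTFT (by unfold gauss3; fun_prop) hσ).enorm
  obtain ⟨N, hN⟩ : ∃ N : Ed d × Ed d × Ed d → ℝ≥0∞, N = fun w =>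
    eNorm volume r₂ fun t₂ => eNorm volume r₁ fun t₁ => eNorm volume r₀ fun x =>
      S (x, t₁, t₂, w.1, w.2.1, w.2.2) := ⟨_, rfl⟩
  have mN : Measurable N := by
    rw [hN]
    refine measurable_eNorm r₂ (F := fun (w : Ed d × Ed d × Ed d) t₂ => eNorm volume r₁ fun t₁ =>
      eNorm volume r₀ fun x => S (x, t₁, t₂, w.1, w.2.1, w.2.2)) ?_
    refine measurable_eNorm r₁ (F := fun (w : (Ed d × Ed d × Ed d) × Ed d) t₁ =>
      eNorm volume r₀ fun x => S (x, t₁, w.2, w.1.1, w.1.2.1, w.1.2.2)) ?_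
    refine measurable_eNorm r₀ (F := fun (w : ((Ed d × Ed d × Ed d) × Ed d) × Ed d) x =>
      S (x, w.2, w.1.2, w.1.1.1, w.1.1.2.1, w.1.1.2.2)) ?_
    unfold Function.uncurry
    fun_prop
  obtain ⟨V, hV⟩ : ∃ V : SchwartzMap (Ed d) ℂ → Ed d × Ed d → ℝ≥0∞,
    V = fun (f : SchwartzMap (Ed d) ℂ) z => ‖STFT d (gauss d) f z.1 z.2‖ₑ := ⟨_, rfl⟩
  have mV : ∀ f, Measurable (V f) := fun f => by rw [hV]; exact mV f
  obtain ⟨B, hB⟩ : ∃ B : ℝ≥0∞ → SchwartzMap (Ed d) ℂ → Ed d → ℝ≥0∞,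
    B = fun p f ξ => eNorm volume p fun t => V f (t, ξ) := ⟨_, rfl⟩
  have mB : ∀ p f, Measurable (B p f) := fun p f => by
    rw [hB]
    exact measurable_eNorm p (F := fun ξ t => V f (t, ξ))
      (by unfold Function.uncurry; have := mV f; fun_prop)
  have mV₁ := mV f₁
  have mV₂ := mV f₂
  have mB₁ := mB p₁ f₁
  have mB₂ := mB p₂ f₂
  obtain ⟨J, hJ⟩ : ∃ J : Ed d × Ed d → Ed d → ℝ≥0∞, J = fun a η =>
    ∫⁻ ξ : Ed d × Ed d, B p₁ f₁ ξ.1 * B p₂ f₂ ξ.2 *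
      N (ξ.1 + a.1, ξ.2 + a.2, η - ξ.1 - ξ.2 - (2 : ℝ) • (a.1 + a.2)) := ⟨_, rfl⟩
  have mJ : Measurable fun q : (Ed d × Ed d) × Ed d => J q.1 q.2 := by
    rw [hJ]
    exact Measurable.lintegral_prod_right' (f := fun q : ((Ed d × Ed d) × Ed d) × Ed d × Ed d =>
      B p₁ f₁ q.2.1 * B p₂ f₂ q.2.2 * N (q.2.1 + q.1.1.1, q.2.2 + q.1.1.2,
        q.1.2 - q.2.1 - q.2.2 - (2 : ℝ) • (q.1.1.1 + q.1.1.2))) (by fun_prop)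
  have key := H (biOp d σ f₁ f₂)
    (ENNReal.ofReal M * ((∫⁻ ξ, ‖FT d f₁ ξ‖ₑ) * ∫⁻ ξ, ‖FT d f₂ ξ‖ₑ))
    (c⁻¹ * (∫⁻ a, G a) * (symbNorm d r₀ r₁ r₂ s₁ s₂ s₃ σ *
      (modNorm d p₁ q₁ f₁ * modNorm d p₂ q₂ f₂)))
    (fun η => c⁻¹ * ∫⁻ a, G a * J a η) (measurable_biOp hσ (mf f₁) (mf f₂))
    (ENNReal.mul_ne_top ENNReal.ofReal_ne_top (ENNReal.mul_ne_top (iF f₁).2.ne (iF f₂).2.ne))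
    (enorm_biOp_le ENNReal.ofReal_ne_top hσB (mf f₁) (mf f₂))
    ((Measurable.lintegral_prod_right' (f := fun q : Ed d × Ed d × Ed d => G q.2 * J q.2 q.1)
      (by fun_prop)).const_mul _)
    (fun η k hk => ?_) (fun k hk => ?_)
  · refine key.trans ?_
    rw [ENNReal.coe_add, ENNReal.coe_toNNReal (by finiteness)]
    calc _ = C * (c⁻¹ * ∫⁻ a, G a) * symbNorm d r₀ r₁ r₂ s₁ s₂ s₃ σ *
          modNorm d p₁ q₁ f₁ * modNorm d p₂ q₂ f₂ := by ring
      _ ≤ _ := by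
        gcongr
        exact le_self_add
  · have hdec := lintegral_mul_le_of_decomposition hc₀ hc₁ hc₂ chain₁ chain₂ chain₃ chain₄ chain₅
      hb hbsum mS mV₁ mV₂ mG hN mN (B₁ := B p₁ f₁) (by rw [hB]) mB₁ (B₂ := B p₂ f₂) (by rw [hB])
      mB₂ η
      (D := fun x => c * ‖STFT d (gaussian d (1 + 4 * Real.pi ^ 2)) (biOp d σ f₁ f₂) x η‖ₑ) hk
      (fun x => by
        rw [hV, hG, hS]
        exact enorm_STFT_biOp_le_lintegral hσ ENNReal.ofReal_ne_top hσB f₁.integrable (iF f₁)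
          (mf f₁) f₂.integrable (iF f₂) (mf f₂) x η)
    simp_rw [mul_left_comm _ c] at hdec
    rw [lintegral_const_mul' _ _ hct] at hdec
    calc ∫⁻ x, k x * ‖STFT d (gaussian d (1 + 4 * Real.pi ^ 2)) (biOp d σ f₁ f₂) x η‖ₑ
        = c⁻¹ * (c * ∫⁻ x, k x *
            ‖STFT d (gaussian d (1 + 4 * Real.pi ^ 2)) (biOp d σ f₁ f₂) x η‖ₑ) := by
          rw [← mul_assoc, ENNReal.inv_mul_cancel hc0 hct, one_mul]
      _ ≤ c⁻¹ * ((∫⁻ a, G a * J a η) * eNorm volume b k) := by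
          rw [hJ]
          gcongr
      _ = _ := by ring
  · have hfreq : ∀ a : Ed d × Ed d, ∫⁻ η, k η * J a η ≤ symbNorm d r₀ r₁ r₂ s₁ s₂ s₃ σ *
        (modNorm d p₁ q₁ f₁ * (modNorm d p₂ q₂ f₂ * eNorm volume b' k)) := by
      intro a
      have := lintegral_mul_lintegral_prod_freq_le hd₁ hd₂ hd₃ chain₆ chain₇ chain₈ chain₉ chain₁₀
        hb' hbsum' mN mB₁ mB₂ hk a.1 a.2 ((2 : ℝ) • (a.1 + a.2))
      rw [hJ]
      refine this.trans_eq ?_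
      rw [hN, hS, hB, hV]
      rfl
    calc ∫⁻ η, k η * (c⁻¹ * ∫⁻ a, G a * J a η)
        = ∫⁻ η, ∫⁻ a, c⁻¹ * G a * (k η * J a η) := by
          congr 1 with η
          rw [← mul_assoc, ← lintegral_const_mul _ (by fun_prop)]
          congr 1 with a
          ring
      _ = ∫⁻ a, ∫⁻ η, c⁻¹ * G a * (k η * J a η) := lintegral_lintegral_swap (by fun_prop)
      _ ≤ ∫⁻ a, c⁻¹ * G a * (symbNorm d r₀ r₁ r₂ s₁ s₂ s₃ σ *
            (modNorm d p₁ q₁ f₁ * (modNorm d p₂ q₂ f₂ * eNorm volume b' k))) := by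
          refine lintegral_mono fun a => ?_
          dsimp only
          rw [lintegral_const_mul _ (by fun_prop)]
          gcongr
          exact hfreq a
      _ = _ := by
          rw [lintegral_mul_const _ (by fun_prop), lintegral_const_mul _ mG]
          ring

end
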